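/- arXiv:2502.02186 — 3 statements merged into one kernel-verified Lean document; each statement's English description precedes it below -/
import Mathlib

section
/- Let q ≥ 2 and λ ∈ (0,1], and define for x ∈ ℝ^m the interpolation norm ‖x‖_{2,q,λ} = inf{ (λ²‖y‖_2² + ‖z‖_q²)^{1/2} : y, z ∈ ℝ^m, x = y + z }. Let g_1, …, g_m be i.i.d. standard Gaussian random variables. Then for all b, c ∈ ℝ^m and every d ≥ 0: E ( d + ‖(b_i + c_i g_i)_{i≤m}‖_{2,q,λ}² )^{1/2} ≤ ( d + ‖b‖_{2,q,λ}² + q·‖c‖_q² )^{1/2}, and also E ( d + ‖(b_i + c_i g_i)_{i≤m}‖_q² )^{1/2} ≤ ( d + ‖b‖_q² + q·‖c‖_q² )^{1/2}. -/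
open MeasureTheory ProbabilityTheory
open scoped ENNReal NNReal

noncomputable section

/-- The `ℓ_r` norm of a finite real vector, `r ∈ [1,∞]`. -/
def lpNorm (r : ℝ≥0∞) {ι : Type*} [Fintype ι] (x : ι → ℝ) : ℝ :=
  if r = ⊤ then ⨆ i, |x i| else (∑ i, |x i| ^ r.toReal) ^ (1 / r.toReal)

/-- The operator norm `‖M‖_{p→q}` expressed via the conjugate exponent `q*`:
the supremum of the bilinear form over `s` in the unit ball of `ℓ_{q*}` and
`t` in the unit ball of `ℓ_p`. -/
def opNorm (p qstar : ℝ≥0∞) {ι κ : Type*} [Fintype ι] [Fintype κ]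
    (M : ι → κ → ℝ) : ℝ :=
  sSup { x : ℝ | ∃ s : ι → ℝ, ∃ t : κ → ℝ,
    lpNorm qstar s ≤ 1 ∧ lpNorm p t ≤ 1 ∧ x = ∑ i, ∑ j, M i j * s i * t j }

/-- The standard Gaussian product measure on `ι → ℝ` (iid `N(0,1)` coordinates). -/
def stdGaussian (ι : Type*) [Fintype ι] : Measure (ι → ℝ) :=
  Measure.pi fun _ => gaussianReal 0 1

/-- `Log x = max 1 (ln x)`; in particular `Log 0 = 1`. -/
def Log (x : ℝ) : ℝ := max 1 (Real.log x)

/-- `E‖G_A‖_{p→q}` for the Gaussian matrix `G_A = (a_{ij} g_{ij})`. -/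
def EopNorm (p qstar : ℝ≥0∞) {m n : ℕ} (A : Fin m → Fin n → ℝ) : ℝ :=
  ∫ g : Fin m × Fin n → ℝ,
    opNorm p qstar (fun i j => A i j * g (i, j)) ∂ stdGaussian (Fin m × Fin n)

/-- `D1 = max_i ‖(a_{ij})_j‖_{p*}`. -/
def D1 (pstar : ℝ≥0∞) {m n : ℕ} (A : Fin m → Fin n → ℝ) : ℝ :=
  ⨆ i, lpNorm pstar (fun j => A i j)

/-- `D2 = max_j ‖(a_{ij})_i‖_q`. -/
def D2 (q : ℝ≥0∞) {m n : ℕ} (A : Fin m → Fin n → ℝ) : ℝ :=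
  ⨆ j, lpNorm q (fun i => A i j)

/-- `max_{i,j} |a_{ij}|`. -/
def maxEntry {m n : ℕ} (A : Fin m → Fin n → ℝ) : ℝ :=
  ⨆ ij : Fin m × Fin n, |A ij.1 ij.2|

/-- `max_{k ≥ 0} inf_{I ⊂ [m]×[n], |I| = k} √(Log k) · max_{(i,j) ∉ I} |a_{ij}|`
(for `k > mn` the term vanishes, so `k` ranges over `0,…,mn`). -/
def Dinf {m n : ℕ} (A : Fin m → Fin n → ℝ) : ℝ :=
  ⨆ k : Fin (m * n + 1),
    ⨅ I : { I : Finset (Fin m × Fin n) // I.card = k.1 },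
      Real.sqrt (Log (k.1 : ℝ)) *
        ⨆ ij : { ij : Fin m × Fin n // ij ∉ I.1 }, |A ij.1.1 ij.1.2|

/-- `E max_{i,j} |a_{ij} g_{ij}|`. -/
def EmaxGauss {m n : ℕ} (A : Fin m → Fin n → ℝ) : ℝ :=
  ∫ g : Fin m × Fin n → ℝ,
    (⨆ ij : Fin m × Fin n, |A ij.1 ij.2 * g ij|) ∂ stdGaussian (Fin m × Fin n)

/-- The `ℓ_q` norm with a real exponent `q`. -/
def lqNormR (q : ℝ) {m : ℕ} (z : Fin m → ℝ) : ℝ :=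
  (∑ i, |z i| ^ q) ^ (1 / q)

/-- The interpolation norm `‖x‖_{2,q,λ} = inf{ (λ²‖y‖₂² + ‖z‖_q²)^{1/2} : x = y + z }`. -/
def interpNorm (q lam : ℝ) {m : ℕ} (x : Fin m → ℝ) : ℝ :=
  sInf { v : ℝ | ∃ y z : Fin m → ℝ, x = y + z ∧
    v = Real.sqrt (lam ^ 2 * (∑ i, y i ^ 2) + lqNormR q z ^ 2) }

/-- Gaussian integration by parts (Stein's identity). -/
lemma integral_id_mul_gaussianReal {u u' : ℝ → ℝ} (hu : ∀ x, HasDerivAt u (u' x) x)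
    (hu_int : Integrable u (gaussianReal 0 1))
    (hu_mul : Integrable (fun x => x * u x) (gaussianReal 0 1))
    (hu'_int : Integrable u' (gaussianReal 0 1)) :
    ∫ x, x * u x ∂gaussianReal 0 1 = ∫ x, u' x ∂gaussianReal 0 1 := by
  have key : ∀ f : ℝ → ℝ, Integrable f (gaussianReal 0 1) →
      Integrable (fun x => gaussianPDFReal 0 1 x * f x) := by
    intro f hf
    rw [gaussianReal_of_var_ne_zero 0 one_ne_zero,
      integrable_withDensity_iff_integrable_smul' (measurable_gaussianPDF 0 1)
        (ae_of_all _ fun x => gaussianPDF_lt_top)] at hf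
    simpa [toReal_gaussianPDF] using hf
  have hpdf : ∀ x, HasDerivAt (gaussianPDFReal 0 1) (-(x * gaussianPDFReal 0 1 x)) x := by
    intro x
    have h : HasDerivAt (fun x : ℝ => -(x - 0) ^ 2 / (2 * ((1 : ℝ≥0) : ℝ))) (-x) x := by
      have h0 : HasDerivAt (fun x : ℝ => (x - 0) ^ 2) (2 * x) x := by
        simpa using ((hasDerivAt_id' x).sub_const 0).fun_pow 2
      refine (h0.fun_neg.div_const (2 * ((1 : ℝ≥0) : ℝ))).congr_deriv ?_
      rw [NNReal.coe_one]
      ring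
    unfold gaussianPDFReal
    refine (h.exp.const_mul ((√(2 * Real.pi * ((1 : ℝ≥0) : ℝ)))⁻¹)).congr_deriv ?_
    ring
  have h := integral_mul_deriv_eq_deriv_mul_of_integrable (u := u) (u' := u')
    (v := gaussianPDFReal 0 1) (v' := fun x => -(x * gaussianPDFReal 0 1 x))
    (fun x _ => hu x) (fun x _ => hpdf x)
    ((key _ hu_mul).neg.congr (ae_of_all _ fun x => by simp; ring))
    ((key _ hu'_int).congr (ae_of_all _ fun x => by simp; ring))
    ((key _ hu_int).congr (ae_of_all _ fun x => by simp; ring))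
  rw [integral_gaussianReal_eq_integral_smul one_ne_zero,
    integral_gaussianReal_eq_integral_smul one_ne_zero]
  have h1 : ∫ x, gaussianPDFReal 0 1 x • (x * u x) =
      -∫ x, u x * -(x * gaussianPDFReal 0 1 x) := by
    rw [← integral_neg]
    congr 1 with x
    simp only [smul_eq_mul]
    ring
  rw [h1, h, neg_neg]
  congr 1 with x
  simp only [smul_eq_mul]
  ring

lemma integrable_one_add_abs_rpow_gaussianReal {r : ℝ} (hr : 0 < r) :
    Integrable (fun x : ℝ => (1 + |x|) ^ r) (gaussianReal 0 1) := by
  have h : MemLp (fun x : ℝ => 1 + |x|) (r.toNNReal : ℝ≥0∞) (gaussianReal 0 1) :=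
    MemLp.add (f := fun _ => (1 : ℝ)) (g := fun x : ℝ => |x|) (memLp_const 1)
      (memLp_id_gaussianReal r.toNNReal).norm
  have h2 := h.integrable_norm_rpow (by simpa using hr) ENNReal.coe_ne_top
  refine h2.congr (ae_of_all _ fun x => ?_)
  simp only [Real.norm_eq_abs, ENNReal.coe_toReal, Real.coe_toNNReal r hr.le]
  rw [abs_of_nonneg (by positivity)]

lemma MeasureTheory.Integrable.rpow_of_le_one {Ω : Type*} [MeasurableSpace Ω] {μ : Measure Ω}
    [IsProbabilityMeasure μ] {Y : Ω → ℝ} {r : ℝ} (hY : Integrable Y μ) (hY0 : ∀ ω, 0 ≤ Y ω)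
    (hr0 : 0 ≤ r) (hr1 : r ≤ 1) : Integrable (fun ω => Y ω ^ r) μ := by
  refine ((integrable_const 1).add hY).mono' (hY.aemeasurable.pow_const r).aestronglyMeasurable
    (ae_of_all _ fun ω => ?_)
  rw [Real.norm_eq_abs, abs_of_nonneg (Real.rpow_nonneg (hY0 ω) r)]
  calc Y ω ^ r ≤ (1 + Y ω) ^ r := by
        gcongr
        · exact hY0 ω
        · linarith
    _ ≤ (1 + Y ω) ^ (1 : ℝ) :=
        Real.rpow_le_rpow_of_exponent_le (by linarith [hY0 ω]) hr1
    _ = _ := by simp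

lemma integral_rpow_le_rpow_integral {Ω : Type*} [MeasurableSpace Ω] {μ : Measure Ω}
    [IsProbabilityMeasure μ] {Y : Ω → ℝ} {r : ℝ} (hY : Integrable Y μ) (hY0 : ∀ ω, 0 ≤ Y ω)
    (hr0 : 0 ≤ r) (hr1 : r ≤ 1) : ∫ ω, Y ω ^ r ∂μ ≤ (∫ ω, Y ω ∂μ) ^ r :=
  (Real.concaveOn_rpow hr0 hr1).le_map_integral
    (Real.continuous_rpow_const hr0).continuousOn isClosed_Ici (ae_of_all _ hY0) hY
    (hY.rpow_of_le_one hY0 hr0 hr1)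

/-- Hypercontractivity for the smooth approximation `(x² + δ)^p` of `|x|^{2p}`, by differentiating
along the path `b + t c g`, `t ∈ [0, 1]`. -/
lemma integral_sq_add_rpow_gaussianReal_le {p δ : ℝ} (hp : 1 ≤ p) (hδ0 : 0 < δ) (hδ1 : δ ≤ 1)
    (b c : ℝ) :
    Integrable (fun x => ((b + c * x) ^ 2 + δ) ^ p) (gaussianReal 0 1) ∧
    ∫ x, ((b + c * x) ^ 2 + δ) ^ p ∂gaussianReal 0 1 ≤
      (b ^ 2 + δ + (2 * p - 1) * c ^ 2) ^ p := by
  set γ := gaussianReal 0 1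
  have hp0 : 0 < p := by linarith
  set C : ℝ := |b| + 2 * |c| + 1 with hC
  have hC1 : 1 ≤ C := by rw [hC]; linarith [abs_nonneg b, abs_nonneg c]
  set W : ℝ → ℝ := fun x => C * (1 + |x|) with hW
  have hW1 : ∀ x, 1 ≤ W x := fun x => by
    simp only [hW]; nlinarith [abs_nonneg x]
  set h : ℝ → ℝ → ℝ := fun t x => (b + t * c * x) ^ 2 + δ with hh
  have hpos : ∀ t x, 0 < h t x := fun t x => by simp only [hh]; positivity
  have hX : ∀ t ∈ Set.Ioo (-1 : ℝ) 2, ∀ x, |b + t * c * x| + 1 ≤ W x := by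
    intro t ht x
    have ht2 : |t| ≤ 2 := by rw [abs_le]; constructor <;> linarith [ht.1, ht.2]
    have h1 : |b + t * c * x| ≤ |b| + 2 * (|c| * |x|) := by
      refine (abs_add_le _ _).trans ?_
      rw [abs_mul, abs_mul, mul_assoc]
      gcongr
    simp only [hW, hC]
    nlinarith [abs_nonneg x, abs_nonneg b, abs_nonneg c,
      mul_nonneg (abs_nonneg b) (abs_nonneg x)]
  have hhW : ∀ t ∈ Set.Ioo (-1 : ℝ) 2, ∀ x, h t x ≤ W x ^ 2 := by
    intro t ht x
    have h1 := hX t ht x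
    have h2 : (|b + t * c * x| + 1) ^ 2 ≤ W x ^ 2 := by gcongr
    simp only [hh]
    nlinarith [abs_nonneg (b + t * c * x), sq_abs (b + t * c * x)]
  have hpow : ∀ t ∈ Set.Ioo (-1 : ℝ) 2, ∀ x, ∀ r : ℝ, 0 ≤ r → h t x ^ r ≤ W x ^ (2 * r) := by
    intro t ht x r hr
    rw [Real.rpow_mul (by linarith [hW1 x]), Real.rpow_two]
    exact Real.rpow_le_rpow (hpos t x).le (hhW t ht x) hr
  have hWint : Integrable (fun x => W x ^ (2 * p)) γ := by
    have := (integrable_one_add_abs_rpow_gaussianReal (r := 2 * p) (by linarith)).const_mul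
      (C ^ (2 * p))
    refine this.congr (ae_of_all _ fun x => ?_)
    simp only [hW]
    rw [Real.mul_rpow (by linarith) (by positivity)]
  have hcont : ∀ t (r : ℝ), Continuous fun x => h t x ^ r := by
    intro t r
    refine Continuous.rpow_const (by simp only [hh]; fun_prop) fun x => Or.inl (hpos t x).ne'
  have hint : ∀ t ∈ Set.Ioo (-1 : ℝ) 2, Integrable (fun x => h t x ^ p) γ := by
    intro t ht
    refine hWint.mono' (hcont t p).aestronglyMeasurable (ae_of_all _ fun x => ?_)
    rw [Real.norm_eq_abs, abs_of_nonneg (Real.rpow_nonneg (hpos t x).le _)]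
    exact hpow t ht x p hp0.le
  -- `u t x` is the derivative of `y ↦ (y ^ 2 + δ) ^ p` at `b + t * c * x`
  set u : ℝ → ℝ → ℝ := fun t x => 2 * p * (b + t * c * x) * h t x ^ (p - 1) with hu
  have hubound : ∀ t ∈ Set.Ioo (-1 : ℝ) 2, ∀ x,
      |u t x| ≤ 2 * p * (W x * W x ^ (2 * (p - 1))) := by
    intro t ht x
    simp only [hu]
    rw [abs_mul, abs_mul, abs_of_nonneg (by linarith : 0 ≤ 2 * p),
      abs_of_nonneg (Real.rpow_nonneg (hpos t x).le _), mul_assoc]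
    have h1 := hX t ht x
    have h2 := hpow t ht x (p - 1) (by linarith)
    have h3 := hW1 x
    gcongr
    linarith
  have hWmul : ∀ x, W x * (W x * W x ^ (2 * (p - 1))) = W x ^ (2 * p) := by
    intro x
    have h0 : 0 < W x := by linarith [hW1 x]
    rw [← mul_assoc, ← sq, ← Real.rpow_two, ← Real.rpow_add h0]
    congr 1; ring
  have hxW : ∀ x, |x| ≤ W x := fun x => by
    simp only [hW]; nlinarith [abs_nonneg x]
  have hW0 : ∀ x, 0 < W x := fun x => by linarith [hW1 x]
  have huc : ∀ t, Continuous (u t) := by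
    intro t
    simp only [hu]
    exact (by fun_prop : Continuous fun x => 2 * p * (b + t * c * x)).mul (hcont t _)
  have hxu : ∀ t ∈ Set.Ioo (-1 : ℝ) 2, ∀ x, |x * u t x| ≤ 2 * p * W x ^ (2 * p) := by
    intro t ht x
    rw [abs_mul, ← hWmul x]
    calc |x| * |u t x| ≤ W x * (2 * p * (W x * W x ^ (2 * (p - 1)))) :=
          mul_le_mul (hxW x) (hubound t ht x) (abs_nonneg _) (hW0 x).le
      _ = _ := by ring
  have hxu_int : ∀ t ∈ Set.Ioo (-1 : ℝ) 2, Integrable (fun x => x * u t x) γ := fun t ht =>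
    (hWint.const_mul (2 * p)).mono' (continuous_id.mul (huc t)).aestronglyMeasurable
      (ae_of_all _ fun x => hxu t ht x)
  have hu_int : ∀ t ∈ Set.Ioo (-1 : ℝ) 2, Integrable (u t) γ := fun t ht =>
    (hWint.const_mul (2 * p)).mono' (huc t).aestronglyMeasurable (ae_of_all _ fun x => by
      refine (hubound t ht x).trans ?_
      rw [← hWmul x]
      have h1 : 0 ≤ W x * W x ^ (2 * (p - 1)) := mul_nonneg (hW0 x).le
        (Real.rpow_nonneg (hW0 x).le _)
      have h2 := hW1 x
      gcongr
      nlinarith)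
  set k : ℝ → ℝ → ℝ := fun t x =>
    2 * p * h t x ^ (p - 1) + 4 * p * (p - 1) * ((b + t * c * x) ^ 2 * h t x ^ (p - 2)) with hk
  have hk0 : ∀ t x, 0 ≤ k t x := by
    intro t x
    have h1 := Real.rpow_nonneg (hpos t x).le (p - 1)
    have h2 := Real.rpow_nonneg (hpos t x).le (p - 2)
    have h3 : 0 ≤ p - 1 := by linarith
    simp only [hk]; positivity
  have hk_le : ∀ t x, k t x ≤ 2 * p * (2 * p - 1) * h t x ^ (p - 1) := by
    intro t x
    have h2 := Real.rpow_nonneg (hpos t x).le (p - 2)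
    have h3 : h t x ^ (p - 1) = h t x * h t x ^ (p - 2) := by
      conv_rhs => rw [← Real.rpow_one (h t x), ← Real.rpow_mul (hpos t x).le, one_mul,
        ← Real.rpow_add (hpos t x)]
      congr 1; ring
    have h4 : (b + t * c * x) ^ 2 * h t x ^ (p - 2) ≤ h t x ^ (p - 1) := by
      rw [h3]
      gcongr
      simp only [hh]; linarith
    have h5 : 0 ≤ 4 * p * (p - 1) := by
      have : 0 ≤ p - 1 := by linarith
      positivity
    simp only [hk]
    nlinarith [mul_le_mul_of_nonneg_left h4 h5]
  have hkc : ∀ t, Continuous (k t) := by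
    intro t
    simp only [hk]
    exact ((hcont t (p - 1)).const_mul _).add
      (((by fun_prop : Continuous fun x => (b + t * c * x) ^ 2).mul (hcont t (p - 2))).const_mul _)
  have hpm_int : ∀ t ∈ Set.Ioo (-1 : ℝ) 2, Integrable (fun x => h t x ^ (p - 1)) γ := by
    intro t ht
    refine hWint.mono' (hcont t _).aestronglyMeasurable (ae_of_all _ fun x => ?_)
    rw [Real.norm_eq_abs, abs_of_nonneg (Real.rpow_nonneg (hpos t x).le _)]
    exact (hpow t ht x (p - 1) (by linarith)).trans
      (Real.rpow_le_rpow_of_exponent_le (hW1 x) (by linarith))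
  have hk_int : ∀ t ∈ Set.Ioo (-1 : ℝ) 2, Integrable (k t) γ := fun t ht =>
    ((hpm_int t ht).const_mul (2 * p * (2 * p - 1))).mono' (hkc t).aestronglyMeasurable
      (ae_of_all _ fun x => by
        rw [Real.norm_eq_abs, abs_of_nonneg (hk0 t x)]
        exact hk_le t x)
  have hu_deriv : ∀ t x, HasDerivAt (u t) (t * c * k t x) x := by
    intro t x
    have h1 : HasDerivAt (fun x => b + t * c * x) (t * c) x := by
      simpa using ((hasDerivAt_id x).const_mul (t * c)).const_add b
    have h2 : HasDerivAt (h t) (2 * (b + t * c * x) * (t * c)) x :=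
      ((h1.fun_pow 2).add_const δ).congr_deriv (by simp)
    have h3 := h2.rpow_const (p := p - 1) (Or.inl (hpos t x).ne')
    refine ((h1.const_mul (2 * p)).mul h3).congr_deriv ?_
    simp only [hk]
    rw [show p - 1 - 1 = p - 2 by ring]
    ring
  have hstein : ∀ t ∈ Set.Ioo (-1 : ℝ) 2, ∫ x, x * u t x ∂γ = t * c * ∫ x, k t x ∂γ := by
    intro t ht
    rw [← integral_const_mul]
    exact integral_id_mul_gaussianReal (hu_deriv t) (hu_int t ht) (hxu_int t ht)
      ((hk_int t ht).const_mul _)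
  set M : ℝ → ℝ := fun t => ∫ x, h t x ^ p ∂γ with hM
  have hM_deriv : ∀ t ∈ Set.Ioo (-1 : ℝ) 2,
      HasDerivAt M (t * c ^ 2 * ∫ x, k t x ∂γ) t := by
    intro t ht
    have h1 := (hasDerivAt_integral_of_dominated_loc_of_deriv_le (μ := γ)
      (F := fun t x => h t x ^ p) (F' := fun t x => c * (x * u t x))
      (bound := fun x => |c| * (2 * p * W x ^ (2 * p))) (isOpen_Ioo.mem_nhds ht)
      (Filter.Eventually.of_forall fun t => (hcont t p).aestronglyMeasurable) (hint t ht)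
      ((hxu_int t ht).const_mul c).aestronglyMeasurable
      (ae_of_all _ fun x t ht => by
        rw [Real.norm_eq_abs, abs_mul]
        have := hxu t ht x
        gcongr)
      ((hWint.const_mul (2 * p)).const_mul |c|)
      (ae_of_all _ fun x t _ => by
        have h1 : HasDerivAt (fun t => b + t * c * x) (c * x) t := by
          simpa using (((hasDerivAt_id t).mul_const c).mul_const x).const_add b
        have h2 : HasDerivAt (fun t => h t x) (2 * (b + t * c * x) * (c * x)) t :=
          ((h1.fun_pow 2).add_const δ).congr_deriv (by simp)
        refine (h2.rpow_const (p := p) (Or.inl (hpos t x).ne')).congr_deriv ?_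
        simp only [hu]
        ring)).2
    refine h1.congr_deriv ?_
    rw [integral_const_mul, hstein t ht]
    ring
  have hM_pos : ∀ t ∈ Set.Ioo (-1 : ℝ) 2, 0 < M t := by
    intro t ht
    have h1 : ∫ _, δ ^ p ∂γ ≤ M t := by
      refine integral_mono (integrable_const _) (hint t ht) fun x => ?_
      refine Real.rpow_le_rpow hδ0.le ?_ hp0.le
      simp only [hh]; nlinarith [sq_nonneg (b + t * c * x)]
    simp only [integral_const, probReal_univ, one_smul] at h1
    exact (Real.rpow_pos_of_pos hδ0 p).trans_le h1
  have hIcc : ∀ t ∈ Set.Icc (0 : ℝ) 1, t ∈ Set.Ioo (-1 : ℝ) 2 := fun t ht =>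
    ⟨by linarith [ht.1], by linarith [ht.2]⟩
  have hN_deriv : ∀ t ∈ Set.Icc (0 : ℝ) 1, HasDerivAt (fun t => M t ^ (1 / p))
      (t * c ^ 2 * (∫ x, k t x ∂γ) * (1 / p) * M t ^ (1 / p - 1)) t := fun t ht =>
    (hM_deriv t (hIcc t ht)).rpow_const (Or.inl (hM_pos t (hIcc t ht)).ne')
  have hN_le : ∀ t ∈ Set.Icc (0 : ℝ) 1,
      t * c ^ 2 * (∫ x, k t x ∂γ) * (1 / p) * M t ^ (1 / p - 1) ≤
        (2 * p - 1) * c ^ 2 * (2 * t) := by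
    intro t ht
    have ht' := hIcc t ht
    have h1 : ∫ x, k t x ∂γ ≤ 2 * p * (2 * p - 1) * ∫ x, h t x ^ (p - 1) ∂γ := by
      rw [← integral_const_mul]
      exact integral_mono (hk_int t ht') ((hpm_int t ht').const_mul _) (hk_le t)
    have h2 : ∫ x, h t x ^ (p - 1) ∂γ ≤ M t ^ (1 - 1 / p) := by
      have h3 := integral_rpow_le_rpow_integral (r := 1 - 1 / p) (hint t ht')
        (fun x => Real.rpow_nonneg (hpos t x).le p)
        (by rw [sub_nonneg, div_le_one hp0]; exact hp) (by simp; positivity)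
      refine le_of_eq_of_le ?_ h3
      congr 1 with x
      rw [← Real.rpow_mul (hpos t x).le]
      congr 1
      field_simp
    have h4 : M t ^ (1 - 1 / p) * M t ^ (1 / p - 1) = 1 := by
      rw [← Real.rpow_add (hM_pos t ht')]
      simp
    have h5 := Real.rpow_nonneg (hM_pos t ht').le (1 / p - 1)
    have ht0 := ht.1
    have h6 : 0 ≤ 2 * p - 1 := by linarith
    calc t * c ^ 2 * (∫ x, k t x ∂γ) * (1 / p) * M t ^ (1 / p - 1)
        ≤ t * c ^ 2 * (2 * p * (2 * p - 1) * M t ^ (1 - 1 / p)) * (1 / p) *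
            M t ^ (1 / p - 1) := by
          gcongr
          exact h1.trans (by gcongr)
      _ = (2 * p - 1) * c ^ 2 * (2 * t) * (M t ^ (1 - 1 / p) * M t ^ (1 / p - 1)) := by
          field_simp
      _ = _ := by rw [h4, mul_one]
  have hB : ∀ t : ℝ, HasDerivAt (fun t => b ^ 2 + δ + (2 * p - 1) * c ^ 2 * t ^ 2)
      ((2 * p - 1) * c ^ 2 * (2 * t)) t := fun t => by
    simpa using ((hasDerivAt_pow 2 t).const_mul ((2 * p - 1) * c ^ 2)).const_add (b ^ 2 + δ)
  have hM0 : M 0 ^ (1 / p) = b ^ 2 + δ := by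
    simp only [hM, hh, zero_mul, add_zero, integral_const, probReal_univ, one_smul]
    rw [← Real.rpow_mul (by positivity), mul_one_div_cancel hp0.ne', Real.rpow_one]
  have hfin := image_le_of_deriv_right_le_deriv_boundary (a := 0) (b := 1)
    (fun t ht => (hN_deriv t ht).continuousAt.continuousWithinAt)
    (fun t ht => (hN_deriv t (Set.Ico_subset_Icc_self ht)).hasDerivWithinAt)
    (B := fun t => b ^ 2 + δ + (2 * p - 1) * c ^ 2 * t ^ 2) (by rw [hM0]; simp)
    (fun t _ => (hB t).continuousAt.continuousWithinAt)
    (fun t _ => (hB t).hasDerivWithinAt)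
    (fun t ht => hN_le t (Set.Ico_subset_Icc_self ht)) (Set.right_mem_Icc.2 zero_le_one)
  have h1mem := hIcc 1 (Set.right_mem_Icc.2 zero_le_one)
  have hfin2 := Real.rpow_le_rpow (Real.rpow_nonneg (hM_pos 1 h1mem).le _) hfin hp0.le
  rw [← Real.rpow_mul (hM_pos 1 h1mem).le, one_div_mul_cancel hp0.ne', Real.rpow_one] at hfin2
  have hi := hint 1 h1mem
  simp only [hM, hh, one_mul, one_pow, mul_one] at hfin2 hi
  exact ⟨hi, hfin2⟩

/-- Gaussian hypercontractivity for affine functions. -/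
lemma integral_abs_rpow_gaussianReal_le {q : ℝ} (hq : 2 ≤ q) (b c : ℝ) :
    Integrable (fun x => |b + c * x| ^ q) (gaussianReal 0 1) ∧
    ∫ x, |b + c * x| ^ q ∂gaussianReal 0 1 ≤ (b ^ 2 + (q - 1) * c ^ 2) ^ (q / 2) := by
  have hp : 1 ≤ q / 2 := by linarith
  have hle : ∀ δ : ℝ, 0 < δ → ∀ x, |b + c * x| ^ q ≤ ((b + c * x) ^ 2 + δ) ^ (q / 2) := by
    intro δ hδ x
    calc |b + c * x| ^ q = ((b + c * x) ^ 2) ^ (q / 2) := by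
          rw [← sq_abs, ← Real.rpow_two, ← Real.rpow_mul (abs_nonneg _)]
          congr 1; ring
      _ ≤ _ := by gcongr; linarith
  have hint : Integrable (fun x => |b + c * x| ^ q) (gaussianReal 0 1) := by
    refine (integral_sq_add_rpow_gaussianReal_le hp one_pos le_rfl b c).1.mono'
      (Continuous.rpow_const (by fun_prop)
        fun x => Or.inr (by linarith)).aestronglyMeasurable (ae_of_all _ fun x => ?_)
    rw [Real.norm_eq_abs, abs_of_nonneg (by positivity)]
    exact hle 1 one_pos x
  refine ⟨hint, ?_⟩
  have hlim : Filter.Tendsto (fun δ : ℝ => (b ^ 2 + δ + (2 * (q / 2) - 1) * c ^ 2) ^ (q / 2))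
      (nhdsWithin 0 (Set.Ioi 0)) (nhds ((b ^ 2 + (q - 1) * c ^ 2) ^ (q / 2))) := by
    have hc : Continuous fun δ : ℝ => (b ^ 2 + δ + (2 * (q / 2) - 1) * c ^ 2) ^ (q / 2) :=
      Continuous.rpow_const (by fun_prop) fun x => Or.inr (by linarith)
    have := hc.tendsto 0
    rw [add_zero, show 2 * (q / 2) - 1 = q - 1 by ring] at this
    simp only [show 2 * (q / 2) - 1 = q - 1 by ring]
    exact this.mono_left nhdsWithin_le_nhds
  refine ge_of_tendsto hlim ?_
  filter_upwards [Ioc_mem_nhdsGT one_pos] with δ hδ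
  obtain ⟨h1, h2⟩ := integral_sq_add_rpow_gaussianReal_le hp hδ.1 hδ.2 b c
  exact (integral_mono hint h1 (hle δ hδ.1)).trans h2

lemma lqNormR_sq {q : ℝ} {m : ℕ} (z : Fin m → ℝ) :
    lqNormR q z ^ 2 = (∑ i, |z i| ^ q) ^ (2 / q) := by
  have h0 : 0 ≤ ∑ i, |z i| ^ q := Finset.sum_nonneg fun i _ => by positivity
  rw [lqNormR, ← Real.rpow_two, ← Real.rpow_mul h0]
  congr 1; ring

lemma sum_sq_add_rpow_le {q : ℝ} (hq : 2 ≤ q) {m : ℕ} (b c : Fin m → ℝ) :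
    (∑ i, (b i ^ 2 + (q - 1) * c i ^ 2) ^ (q / 2)) ^ (2 / q) ≤
      lqNormR q b ^ 2 + q * lqNormR q c ^ 2 := by
  have hpow : ∀ x : ℝ, (x ^ 2) ^ (q / 2) = |x| ^ q := fun x => by
    rw [← sq_abs, ← Real.rpow_two, ← Real.rpow_mul (abs_nonneg _)]
    congr 1; ring
  have h0 : 0 ≤ ∑ i, |c i| ^ q := Finset.sum_nonneg fun i _ => by positivity
  have h := Real.Lp_add_le_of_nonneg Finset.univ (p := q / 2) (f := fun i => b i ^ 2)
    (g := fun i => (q - 1) * c i ^ 2) (by linarith) (fun i _ => sq_nonneg _)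
    (fun i _ => mul_nonneg (by linarith) (sq_nonneg _))
  simp only [one_div_div, Real.mul_rpow (by linarith : 0 ≤ q - 1) (sq_nonneg _), hpow,
    ← Finset.mul_sum] at h
  rw [Real.mul_rpow (by apply Real.rpow_nonneg; linarith) h0,
    ← Real.rpow_mul (by linarith), div_mul_div_cancel₀ (by positivity),
    div_self (by positivity), Real.rpow_one, ← lqNormR_sq, ← lqNormR_sq] at h
  nlinarith [sq_nonneg (lqNormR q c)]

instance isProbabilityMeasure_stdGaussian (ι : Type*) [Fintype ι] :
    IsProbabilityMeasure (stdGaussian ι) := by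
  unfold _root_.stdGaussian; infer_instance

lemma lqNormR_hypercontractivity {q : ℝ} (hq : 2 ≤ q) {m : ℕ} (b c : Fin m → ℝ) {d : ℝ}
    (hd : 0 ≤ d) :
    Integrable (fun g : Fin m → ℝ => √(d + lqNormR q (fun i => b i + c i * g i) ^ 2))
      (stdGaussian (Fin m)) ∧
    ∫ g : Fin m → ℝ, √(d + lqNormR q (fun i => b i + c i * g i) ^ 2) ∂stdGaussian (Fin m) ≤
      √(d + lqNormR q b ^ 2 + q * lqNormR q c ^ 2) := by
  have hr0 : 0 ≤ 2 / q := by positivity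
  have hr1 : 2 / q ≤ 1 := by rw [div_le_one (by linarith)]; exact hq
  simp only [lqNormR_sq (q := q) fun i => b i + c i * _, Real.sqrt_eq_rpow]
  set S : (Fin m → ℝ) → ℝ := fun g => ∑ i, |b i + c i * g i| ^ q with hS
  have hS0 : ∀ g, 0 ≤ S g := fun g => Finset.sum_nonneg fun i _ => by positivity
  have hterm : ∀ i, Integrable (fun g : Fin m → ℝ => |b i + c i * g i| ^ q)
      (stdGaussian (Fin m)) := fun i =>
    integrable_comp_eval (μ := fun _ : Fin m => gaussianReal 0 1) (i := i)
      (integral_abs_rpow_gaussianReal_le hq (b i) (c i)).1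
  have hSint : Integrable S (stdGaussian (Fin m)) := integrable_finsetSum _ fun i _ => hterm i
  have hSle : ∫ g, S g ∂stdGaussian (Fin m) ≤
      ∑ i, (b i ^ 2 + (q - 1) * c i ^ 2) ^ (q / 2) := by
    simp only [hS]
    rw [integral_finsetSum _ fun i _ => hterm i]
    refine Finset.sum_le_sum fun i _ => ?_
    obtain ⟨h1, h2⟩ := integral_abs_rpow_gaussianReal_le hq (b i) (c i)
    refine le_of_eq_of_le ?_ h2
    exact integral_comp_eval (μ := fun _ : Fin m => gaussianReal 0 1) (i := i)
      h1.aestronglyMeasurable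
  have hSr := hSint.rpow_of_le_one hS0 hr0 hr1
  have hY0 : ∀ g, 0 ≤ d + S g ^ (2 / q) := fun g => add_nonneg hd (Real.rpow_nonneg (hS0 g) _)
  have hY : Integrable (fun g => d + S g ^ (2 / q)) (stdGaussian (Fin m)) :=
    (integrable_const d).add hSr
  refine ⟨hY.rpow_of_le_one hY0 (by norm_num) (by norm_num), ?_⟩
  refine (integral_rpow_le_rpow_integral hY hY0 (by norm_num) (by norm_num)).trans ?_
  refine Real.rpow_le_rpow (integral_nonneg hY0) ?_ (by norm_num)
  rw [integral_add (integrable_const d) hSr, integral_const, probReal_univ, one_smul, add_assoc]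
  gcongr
  refine (integral_rpow_le_rpow_integral hSint hS0 hr0 hr1).trans ?_
  refine le_trans ?_ (sum_sq_add_rpow_le hq b c)
  exact Real.rpow_le_rpow (integral_nonneg hS0) hSle hr0

lemma interpNorm_nonneg (q lam : ℝ) {m : ℕ} (x : Fin m → ℝ) : 0 ≤ interpNorm q lam x := by
  refine Real.sInf_nonneg ?_
  rintro v ⟨y, z, -, rfl⟩
  exact Real.sqrt_nonneg _

lemma interpNorm_sq_add_le (q lam : ℝ) {m : ℕ} (y z : Fin m → ℝ) :
    interpNorm q lam (y + z) ^ 2 ≤ lam ^ 2 * (∑ i, y i ^ 2) + lqNormR q z ^ 2 := by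
  have h0 : 0 ≤ lam ^ 2 * (∑ i, y i ^ 2) + lqNormR q z ^ 2 := by positivity
  rw [← Real.le_sqrt (interpNorm_nonneg _ _ _) h0]
  refine csInf_le ⟨0, ?_⟩ ⟨y, z, rfl, rfl⟩
  rintro v ⟨y, z, -, rfl⟩
  exact Real.sqrt_nonneg _

lemma le_interpNorm_sq {q lam : ℝ} {m : ℕ} {x : Fin m → ℝ} {a : ℝ}
    (h : ∀ y z : Fin m → ℝ, x = y + z →
      a ≤ lam ^ 2 * (∑ i, y i ^ 2) + lqNormR q z ^ 2) :
    a ≤ interpNorm q lam x ^ 2 := by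
  rw [← Real.sqrt_le_left (interpNorm_nonneg q lam x)]
  refine le_csInf ⟨_, 0, x, by simp, rfl⟩ ?_
  rintro v ⟨y, z, hyz, rfl⟩
  exact Real.sqrt_le_sqrt (h y z hyz)

/-- Lemma: hypercontractive property of the interpolation norm:
for `q ≥ 2`, `λ ∈ (0,1]`, `d ≥ 0` and iid standard Gaussians `g_i`,
`E(d + ‖(b_i + c_i g_i)_i‖_{2,q,λ}²)^{1/2} ≤ (d + ‖b‖_{2,q,λ}² + q‖c‖_q²)^{1/2}`, and
`E(d + ‖(b_i + c_i g_i)_i‖_q²)^{1/2} ≤ (d + ‖b‖_q² + q‖c‖_q²)^{1/2}`. -/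
theorem interpolation_norm_hypercontractivity
    (q lam : ℝ) (hq : 2 ≤ q) (hlam0 : 0 < lam) (hlam1 : lam ≤ 1)
    (m : ℕ) (b c : Fin m → ℝ) (d : ℝ) (hd : 0 ≤ d) :
    (∫ g : Fin m → ℝ,
        Real.sqrt (d + interpNorm q lam (fun i => b i + c i * g i) ^ 2)
      ∂ stdGaussian (Fin m)) ≤
      Real.sqrt (d + interpNorm q lam b ^ 2 + q * lqNormR q c ^ 2) ∧
    (∫ g : Fin m → ℝ,
        Real.sqrt (d + lqNormR q (fun i => b i + c i * g i) ^ 2)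
      ∂ stdGaussian (Fin m)) ≤
      Real.sqrt (d + lqNormR q b ^ 2 + q * lqNormR q c ^ 2) := by
  have hq0 : 0 ≤ q := by linarith
  refine ⟨?_, (lqNormR_hypercontractivity hq b c hd).2⟩
  set I := ∫ g : Fin m → ℝ,
    Real.sqrt (d + interpNorm q lam (fun i => b i + c i * g i) ^ 2) ∂ stdGaussian (Fin m) with hI
  have hI0 : 0 ≤ I := integral_nonneg fun g => Real.sqrt_nonneg _
  refine Real.le_sqrt_of_sq_le ?_
  have key : I ^ 2 - d - q * lqNormR q c ^ 2 ≤ interpNorm q lam b ^ 2 := by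
    refine le_interpNorm_sq fun y z hyz => ?_
    have hd' : 0 ≤ d + lam ^ 2 * ∑ i, y i ^ 2 := by positivity
    obtain ⟨h1, h2⟩ := lqNormR_hypercontractivity hq z c hd'
    have h3 : I ≤ √(d + lam ^ 2 * (∑ i, y i ^ 2) + lqNormR q z ^ 2 + q * lqNormR q c ^ 2) := by
      refine le_trans ?_ h2
      refine integral_mono_of_nonneg (ae_of_all _ fun g => Real.sqrt_nonneg _) h1
        (ae_of_all _ fun g => Real.sqrt_le_sqrt ?_)
      have h4 := interpNorm_sq_add_le q lam y fun i => z i + c i * g i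
      have h5 : (y + fun i => z i + c i * g i) = fun i => b i + c i * g i := by
        ext i
        simp only [hyz, Pi.add_apply]
        ring
      rw [h5] at h4
      linarith
    have h6 := (Real.le_sqrt hI0 (by positivity)).1 h3
    linarith
  linarith
end
end

section
/- There is a universal constant C > 0 such that for all p, q with p* ∈ [2,∞) and q ∈ [2,∞), all positive integers m, n, every real m×n matrix A = (a_{ij}), and every partition J_1, J_2, …, J_{k_0} of {1,…,n} into nonempty sets: E‖G_A‖_{p→q} ≤ E‖G_A‖_{2→q} ≤ C·( √q·D2 + max_{1 ≤ k ≤ k_0} max_{1 ≤ l ≤ k} k³·|J_l|^{1/2}·max_{i≤m, j ∈ J_k} |a_{ij}| ). -/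
open MeasureTheory ProbabilityTheory
open scoped ENNReal NNReal

noncomputable section

theorem pi_fin_absolutelyContinuous :
    ∀ {n : ℕ} {α : Fin n → Type} [∀ i, MeasurableSpace (α i)] {μ ν : ∀ i, Measure (α i)}
      [∀ i, SigmaFinite (μ i)] [∀ i, SigmaFinite (ν i)],
      (∀ i, μ i ≪ ν i) → Measure.pi μ ≪ Measure.pi ν
  | 0, _, _, μ, ν, _, _, _ => by rw [Measure.pi_of_empty μ, Measure.pi_of_empty ν]
  | n + 1, _, _, μ, ν, _, _, h => by
    rw [← ((measurePreserving_piFinSuccAbove μ 0).symm _).map_eq,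
      ← ((measurePreserving_piFinSuccAbove ν 0).symm _).map_eq]
    exact ((h 0).prod (pi_fin_absolutelyContinuous fun j => h _)).map
      (MeasurableEquiv.measurable _)

section Concentration

variable {E : Type*} [NormedAddCommGroup E] [InnerProductSpace ℝ E] [FiniteDimensional ℝ E]
  [MeasurableSpace E] [BorelSpace E]

theorem stdGaussian_absolutelyContinuous_volume :
    ProbabilityTheory.stdGaussian E ≪ (volume : Measure E) := by
  have h := (stdOrthonormalBasis ℝ E).measurePreserving_repr_symm.comp
    (PiLp.volume_preserving_toLp (Fin (Module.finrank ℝ E)))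
  rw [ProbabilityTheory.stdGaussian, ← h.map_eq, volume_pi]
  have e : (fun x : Fin (Module.finrank ℝ E) → ℝ => ∑ i, x i • stdOrthonormalBasis ℝ E i)
      = (stdOrthonormalBasis ℝ E).repr.symm ∘ WithLp.toLp 2 := by
    ext x; simp [OrthonormalBasis.sum_repr_symm]
  rw [e]
  exact (pi_fin_absolutelyContinuous fun _ =>
    gaussianReal_absolutelyContinuous 0 one_ne_zero).map h.measurable

theorem map_dual_stdGaussian (L : StrongDual ℝ E) :
    (ProbabilityTheory.stdGaussian E).map L = gaussianReal 0 (‖L‖₊ ^ 2) := by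
  rw [IsGaussian.map_eq_gaussianReal, integral_strongDual_stdGaussian, variance_dual_stdGaussian]
  congr 1
  ext
  simp

theorem lintegral_exp_dual_stdGaussian (L : StrongDual ℝ E) :
    ∫⁻ y, ENNReal.ofReal (Real.exp (L y)) ∂(ProbabilityTheory.stdGaussian E)
      = ENNReal.ofReal (Real.exp (‖L‖ ^ 2 / 2)) := by
  have h1 := mgf_gaussianReal (map_dual_stdGaussian L) 1
  have h2 : Integrable (fun y => Real.exp (L y)) (ProbabilityTheory.stdGaussian E) := by
    have := (integrable_map_measure (μ := ProbabilityTheory.stdGaussian E) (f := L)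
      (g := fun x => Real.exp (1 * x)) (by fun_prop) (by fun_prop)).1
      (by rw [map_dual_stdGaussian]; exact integrable_exp_mul_gaussianReal 1)
    simpa [Function.comp_def] using this
  rw [← ofReal_integral_eq_lintegral_ofReal h2 (by filter_upwards with x; positivity)]
  simp only [mgf, one_mul] at h1
  rw [h1]
  simp

theorem map_rotation_stdGaussian (θ : ℝ) :
    MeasurePreserving (ContinuousLinearMap.rotation (E := E) θ)
      ((ProbabilityTheory.stdGaussian E).prod (ProbabilityTheory.stdGaussian E))
      ((ProbabilityTheory.stdGaussian E).prod (ProbabilityTheory.stdGaussian E)) :=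
  ⟨(ContinuousLinearMap.rotation (E := E) θ).continuous.measurable,
    IsGaussian.map_rotation_eq_self (by simp) θ⟩

theorem measurable_fderiv_apply (F : E → ℝ) :
    Measurable fun p : E × E => fderiv ℝ F p.1 p.2 := by
  have h : Measurable fun x => (InnerProductSpace.toDual ℝ E).symm (fderiv ℝ F x) :=
    (InnerProductSpace.toDual ℝ E).symm.continuous.measurable.comp (measurable_fderiv ℝ F)
  have h2 : Measurable fun p : E × E =>
      inner ℝ ((InnerProductSpace.toDual ℝ E).symm (fderiv ℝ F p.1)) p.2 :=
    (h.comp measurable_fst).inner measurable_snd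
  simpa using h2

omit [FiniteDimensional ℝ E] [MeasurableSpace E] [BorelSpace E] in
theorem hasDerivAt_rotation_fst (p : E × E) (θ : ℝ) :
    HasDerivAt (fun θ => (ContinuousLinearMap.rotation θ p).1)
      (ContinuousLinearMap.rotation θ p).2 θ := by
  simp only [ContinuousLinearMap.rotation_apply]
  exact ((Real.hasDerivAt_cos θ).smul_const p.1).add ((Real.hasDerivAt_sin θ).smul_const p.2)

omit [FiniteDimensional ℝ E] [MeasurableSpace E] [BorelSpace E] in
theorem exp_sub_le_integral_rotation {K : ℝ≥0} {F : E → ℝ} (hF : LipschitzWith K F) (p : E × E) :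
    ENNReal.ofReal (Real.exp (F p.2 - F p.1)) ≤ ENNReal.ofReal (2 / Real.pi) *
      ∫⁻ θ in Set.Ioc 0 (Real.pi / 2), ENNReal.ofReal
        (Real.exp (Real.pi / 2 * deriv (fun θ => F (ContinuousLinearMap.rotation θ p).1) θ)) := by
  set u : ℝ → ℝ := fun θ => F (ContinuousLinearMap.rotation θ p).1 with hu
  set c : ℝ≥0 := ‖p.1‖₊ + ‖p.2‖₊
  have hrot : LipschitzWith c (fun θ : ℝ => (ContinuousLinearMap.rotation θ p).1) := by
    refine lipschitzWith_of_nnnorm_deriv_le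
      (fun θ => (hasDerivAt_rotation_fst p θ).differentiableAt) fun θ => ?_
    rw [(hasDerivAt_rotation_fst p θ).deriv, ContinuousLinearMap.rotation_apply]
    rw [← NNReal.coe_le_coe]
    simp only [coe_nnnorm, c, NNReal.coe_add]
    refine (norm_add_le _ _).trans ?_
    rw [norm_smul, norm_smul, norm_neg]
    have h1 := Real.abs_sin_le_one θ
    have h2 := Real.abs_cos_le_one θ
    simp only [Real.norm_eq_abs]
    gcongr
    · exact mul_le_of_le_one_left (norm_nonneg _) h1
    · exact mul_le_of_le_one_left (norm_nonneg _) h2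
  have hul : LipschitzWith (K * c) u := hF.comp hrot
  have hpi := Real.pi_pos
  have hftc := (hul.lipschitzOnWith (s := Set.uIcc 0 (Real.pi / 2))
    |>.absolutelyContinuousOnInterval).integral_deriv_eq_sub
  have hends : u (Real.pi / 2) - u 0 = F p.2 - F p.1 := by
    simp [hu, ContinuousLinearMap.rotation_apply]
  rw [intervalIntegral.integral_of_le (by positivity), hends] at hftc
  have hbd : ∀ θ, |deriv u θ| ≤ K * c := fun θ => by
    simpa using norm_deriv_le_of_lipschitz hul
  have hmeas : Measurable (deriv u) := measurable_deriv u
  have hfin : IsFiniteMeasure (volume.restrict (Set.Ioc 0 (Real.pi / 2))) := inferInstance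
  have hint1 : Integrable (fun θ => Real.pi / 2 * deriv u θ)
      (volume.restrict (Set.Ioc 0 (Real.pi / 2))) := by
    refine Integrable.of_bound (by fun_prop) (Real.pi / 2 * (K * c)) (ae_of_all _ fun θ => ?_)
    rw [norm_mul, Real.norm_eq_abs, Real.norm_eq_abs, abs_of_pos (by positivity)]
    have := hbd θ
    gcongr
  have hint2 : Integrable (fun θ => Real.exp (Real.pi / 2 * deriv u θ))
      (volume.restrict (Set.Ioc 0 (Real.pi / 2))) := by
    refine Integrable.of_bound (by fun_prop) (Real.exp (Real.pi / 2 * (K * c)))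
      (ae_of_all _ fun θ => ?_)
    rw [Real.norm_eq_abs, abs_of_pos (Real.exp_pos _)]
    gcongr
    exact (le_abs_self _).trans (hbd θ)
  have hJ := convexOn_exp.map_set_average_le Real.continuous_exp.continuousOn isClosed_univ
    (μ := volume) (t := Set.Ioc 0 (Real.pi / 2)) (f := fun θ => Real.pi / 2 * deriv u θ)
    (by simp [hpi]) (by simp) (by simp) hint1 hint2
  rw [setAverage_eq, setAverage_eq, integral_const_mul, hftc] at hJ
  have hvol : volume.real (Set.Ioc 0 (Real.pi / 2)) = Real.pi / 2 := by
    rw [Measure.real, Real.volume_Ioc, sub_zero, ENNReal.toReal_ofReal (by positivity)]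
  rw [hvol, smul_eq_mul, smul_eq_mul, inv_mul_cancel_left₀ (by positivity), inv_div] at hJ
  rw [← ofReal_integral_eq_lintegral_ofReal hint2 (ae_of_all _ fun _ => (Real.exp_pos _).le),
    ← ENNReal.ofReal_mul (by positivity)]
  exact ENNReal.ofReal_le_ofReal hJ

theorem lintegral_exp_sub_le {K : ℝ≥0} {F : E → ℝ} (hF : LipschitzWith K F) :
    ∫⁻ p, ENNReal.ofReal (Real.exp (F p.2 - F p.1))
        ∂((ProbabilityTheory.stdGaussian E).prod (ProbabilityTheory.stdGaussian E))
      ≤ ENNReal.ofReal (Real.exp (Real.pi ^ 2 * K ^ 2 / 8)) := by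
  set γ := ProbabilityTheory.stdGaussian E
  have hpi := Real.pi_pos
  set G : E × E → ℝ≥0∞ := fun p => ENNReal.ofReal (Real.exp (Real.pi / 2 * fderiv ℝ F p.1 p.2))
  have hG : Measurable G := by
    have := measurable_fderiv_apply F
    fun_prop
  have hGint : ∫⁻ p, G p ∂(γ.prod γ) ≤ ENNReal.ofReal (Real.exp (Real.pi ^ 2 * K ^ 2 / 8)) := by
    rw [lintegral_prod _ hG.aemeasurable]
    calc _ ≤ ∫⁻ _, ENNReal.ofReal (Real.exp (Real.pi ^ 2 * K ^ 2 / 8)) ∂γ := by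
          refine lintegral_mono fun x => ?_
          have := lintegral_exp_dual_stdGaussian ((Real.pi / 2) • fderiv ℝ F x)
          simp only [smul_apply, smul_eq_mul] at this
          simp only [G]
          rw [this]
          refine ENNReal.ofReal_le_ofReal (Real.exp_le_exp.2 ?_)
          have hK : ‖fderiv ℝ F x‖ ≤ K := norm_fderiv_le_of_lipschitz ℝ hF
          rw [norm_smul, Real.norm_eq_abs, abs_of_pos (by positivity)]
          have : ‖fderiv ℝ F x‖ ^ 2 ≤ (K : ℝ) ^ 2 := by gcongr
          nlinarith [mul_le_mul_of_nonneg_left this (sq_nonneg Real.pi)]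
      _ = _ := by simp
  have hdiff : ∀ᵐ p ∂(γ.prod γ), DifferentiableAt ℝ F p.1 := by
    have : ∀ᵐ x ∂γ, DifferentiableAt ℝ F x :=
      stdGaussian_absolutelyContinuous_volume.ae_le hF.ae_differentiableAt
    exact Measure.quasiMeasurePreserving_fst.ae this
  have hder : ∀ θ, ∀ᵐ p ∂(γ.prod γ),
      ENNReal.ofReal (Real.exp
        (Real.pi / 2 * deriv (fun θ => F (ContinuousLinearMap.rotation θ p).1) θ))
      = G (ContinuousLinearMap.rotation θ p) := fun θ => by
    filter_upwards [(map_rotation_stdGaussian (E := E) θ).quasiMeasurePreserving.ae hdiff]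
      with p hp
    have := (hp.hasFDerivAt.comp_hasDerivAt θ (hasDerivAt_rotation_fst p θ)).deriv
    simp only [G]
    rw [← this]
    rfl
  have hmeas : Measurable fun z : (E × E) × ℝ => ENNReal.ofReal (Real.exp
        (Real.pi / 2 * deriv (fun θ => F (ContinuousLinearMap.rotation θ z.1).1) z.2)) := by
    have hc : Continuous (Function.uncurry
        fun (p : E × E) (θ : ℝ) => F (ContinuousLinearMap.rotation θ p).1) := by
      have := hF.continuous
      simp only [ContinuousLinearMap.rotation_apply, Function.uncurry_def]
      fun_prop
    have := measurable_deriv_with_param hc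
    fun_prop
  calc _ ≤ ∫⁻ p, ENNReal.ofReal (2 / Real.pi) *
      (∫⁻ θ in Set.Ioc 0 (Real.pi / 2), ENNReal.ofReal (Real.exp
        (Real.pi / 2 * deriv (fun θ => F (ContinuousLinearMap.rotation θ p).1) θ))) ∂(γ.prod γ) :=
        lintegral_mono fun p => exp_sub_le_integral_rotation hF p
    _ = ENNReal.ofReal (2 / Real.pi) * ∫⁻ θ in Set.Ioc 0 (Real.pi / 2), ∫⁻ p, ENNReal.ofReal
        (Real.exp (Real.pi / 2 * deriv (fun θ => F (ContinuousLinearMap.rotation θ p).1) θ))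
        ∂(γ.prod γ) := by
        rw [lintegral_const_mul' _ _ ENNReal.ofReal_ne_top, lintegral_lintegral_swap]
        exact hmeas.aemeasurable
    _ = ENNReal.ofReal (2 / Real.pi) * ∫⁻ _ in Set.Ioc 0 (Real.pi / 2), ∫⁻ p, G p ∂(γ.prod γ) := by
        congr 1
        refine lintegral_congr fun θ => ?_
        rw [lintegral_congr_ae (hder θ)]
        exact (map_rotation_stdGaussian θ).lintegral_comp hG
    _ = ∫⁻ p, G p ∂(γ.prod γ) := by
        rw [setLIntegral_const, Real.volume_Ioc, sub_zero, mul_comm (lintegral _ _), ← mul_assoc,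
          ← ENNReal.ofReal_mul (by positivity), div_mul_div_cancel₀ hpi.ne', div_self two_ne_zero]
        simp
    _ ≤ _ := hGint

theorem integrable_of_lipschitz {K : ℝ≥0} {F : E → ℝ} (hF : LipschitzWith K F) :
    Integrable F (ProbabilityTheory.stdGaussian E) := by
  refine Integrable.mono' (g := fun x => ‖F 0‖ + K * ‖x‖)
    ((integrable_const _).add (IsGaussian.integrable_id.norm.const_mul _))
    hF.continuous.aestronglyMeasurable (ae_of_all _ fun x => ?_)
  have := hF.dist_le_mul x 0
  rw [dist_zero_right, dist_eq_norm] at this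
  linarith [norm_sub_norm_le (F x) (F 0)]

theorem lintegral_exp_sub_integral_le {K : ℝ≥0} {F : E → ℝ} (hF : LipschitzWith K F) :
    ∫⁻ y, ENNReal.ofReal (Real.exp (F y - ∫ x, F x ∂(ProbabilityTheory.stdGaussian E)))
        ∂(ProbabilityTheory.stdGaussian E)
      ≤ ENNReal.ofReal (Real.exp (Real.pi ^ 2 * K ^ 2 / 8)) := by
  set γ := ProbabilityTheory.stdGaussian E
  have hmF := hF.continuous.measurable
  have h := lintegral_exp_sub_le hF
  have hm : Measurable fun p : E × E => ENNReal.ofReal (Real.exp (F p.2 - F p.1)) := by fun_prop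
  rw [lintegral_prod_symm _ hm.aemeasurable] at h
  have hfin : ∀ᵐ y ∂γ, ∫⁻ x, ENNReal.ofReal (Real.exp (F y - F x)) ∂γ < ⊤ :=
    ae_lt_top' (by fun_prop) (h.trans_lt ENNReal.ofReal_lt_top).ne
  refine (lintegral_mono_ae ?_).trans h
  filter_upwards [hfin] with y hy
  have hint : Integrable (fun x => Real.exp (F y - F x)) γ :=
    ⟨by fun_prop, by
      rw [hasFiniteIntegral_iff_ofReal (ae_of_all _ fun _ => (Real.exp_pos _).le)]; exact hy⟩
  rw [← ofReal_integral_eq_lintegral_ofReal hint (ae_of_all _ fun _ => (Real.exp_pos _).le)]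
  refine ENNReal.ofReal_le_ofReal ?_
  have hi : Integrable (fun x => F y - F x) γ :=
    (integrable_const _).sub (integrable_of_lipschitz hF)
  have := convexOn_exp.map_integral_le Real.continuous_exp.continuousOn isClosed_univ
    (by simp) hi hint
  rwa [integral_sub (integrable_const _) (integrable_of_lipschitz hF), integral_const,
    probReal_univ, one_smul] at this

omit [FiniteDimensional ℝ E] [MeasurableSpace E] [BorelSpace E] [InnerProductSpace ℝ E] in
theorem LipschitzWith.finset_sup' {ι : Type*} {T : Finset ι} (hT : T.Nonempty) {K : ℝ≥0}
    {F : ι → E → ℝ} (hF : ∀ t ∈ T, LipschitzWith K (F t)) :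
    LipschitzWith K fun x => T.sup' hT fun t => F t x := by
  refine LipschitzWith.of_le_add_mul K fun x y => Finset.sup'_le _ _ fun t ht => ?_
  have h1 := (hF t ht).le_add_mul x y
  have h2 : F t y ≤ T.sup' hT fun t => F t y := Finset.le_sup' (fun t => F t y) ht
  linarith

theorem integral_sup'_sub_le {ι : Type*} {T : Finset ι} (hT : T.Nonempty) {K : ℝ≥0}
    {F : ι → E → ℝ} (hF : ∀ t ∈ T, LipschitzWith K (F t)) {l : ℝ} (hl : 0 < l) :
    ∫ x, T.sup' hT (fun t => F t x - ∫ y, F t y ∂(ProbabilityTheory.stdGaussian E))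
        ∂(ProbabilityTheory.stdGaussian E)
      ≤ Real.log T.card / l + l * (Real.pi ^ 2 * K ^ 2 / 8) := by
  set γ := ProbabilityTheory.stdGaussian E
  set a : ι → ℝ := fun t => ∫ y, F t y ∂γ
  set Y : E → ℝ := fun x => T.sup' hT fun t => F t x - a t
  have hYL : LipschitzWith K Y :=
    LipschitzWith.finset_sup' hT fun t ht => by simpa using (hF t ht).sub (.const (a t))
  have hYm := hYL.continuous.measurable
  have hcard : 0 < T.card := hT.card_pos
  have hpt : ∀ x, ENNReal.ofReal (Real.exp (l * Y x)) ≤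
      ∑ t ∈ T, ENNReal.ofReal (Real.exp (l * F t x - ∫ y, l * F t y ∂γ)) := fun x => by
    obtain ⟨t, ht, he⟩ := Finset.exists_mem_eq_sup' hT fun t => F t x - a t
    have : Y x = F t x - a t := he
    rw [this, mul_sub, ← integral_const_mul]
    exact Finset.single_le_sum
      (f := fun t => ENNReal.ofReal (Real.exp (l * F t x - ∫ y, l * F t y ∂γ)))
      (fun _ _ => zero_le) ht
  have hlK : ∀ t ∈ T, LipschitzWith (l.toNNReal * K) (fun x => l * F t x) := fun t ht => by
    refine LipschitzWith.of_dist_le_mul fun x y => ?_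
    have := (hF t ht).dist_le_mul x y
    rw [Real.dist_eq, ← mul_sub, abs_mul, abs_of_pos hl, NNReal.coe_mul,
      Real.coe_toNNReal _ hl.le, mul_assoc]
    exact mul_le_mul_of_nonneg_left this hl.le
  set B := Real.exp (Real.pi ^ 2 * (l * K) ^ 2 / 8)
  have hle : ∫⁻ x, ENNReal.ofReal (Real.exp (l * Y x)) ∂γ ≤ ENNReal.ofReal (T.card * B) := by
    refine (lintegral_mono hpt).trans ?_
    rw [lintegral_finsetSum' _ fun t ht => ?_]
    · refine (Finset.sum_le_card_nsmul _ _ (ENNReal.ofReal B) fun t ht => ?_).trans ?_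
      · have := lintegral_exp_sub_integral_le (hlK t ht)
        rwa [NNReal.coe_mul, Real.coe_toNNReal _ hl.le] at this
      · rw [nsmul_eq_mul, ENNReal.ofReal_mul (by positivity), ENNReal.ofReal_natCast]
    · exact ((hlK t ht).continuous.measurable.sub_const _).exp.ennreal_ofReal.aemeasurable
  have hint : Integrable (fun x => Real.exp (l * Y x)) γ :=
    ⟨by fun_prop, by
      rw [hasFiniteIntegral_iff_ofReal (ae_of_all _ fun _ => (Real.exp_pos _).le)]
      exact hle.trans_lt ENNReal.ofReal_lt_top⟩
  rw [← ofReal_integral_eq_lintegral_ofReal hint (ae_of_all _ fun _ => (Real.exp_pos _).le),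
    ENNReal.ofReal_le_ofReal_iff (by positivity)] at hle
  have hJ := (convexOn_exp.map_integral_le Real.continuous_exp.continuousOn isClosed_univ
    (by simp) ((integrable_of_lipschitz hYL).const_mul l) hint).trans hle
  have := Real.log_le_log (Real.exp_pos _) hJ
  rw [Real.log_exp, integral_const_mul, Real.log_mul (by positivity) (Real.exp_pos _).ne',
    Real.log_exp] at this
  change ∫ x, Y x ∂γ ≤ _
  rw [div_add' _ _ _ hl.ne', le_div_iff₀ hl]
  linarith

theorem integral_sup'_le {ι : Type*} {T : Finset ι} (hT : T.Nonempty) {K : ℝ≥0}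
    {F : ι → E → ℝ} (hF : ∀ t ∈ T, LipschitzWith K (F t)) {a : ι → ℝ}
    (ha : ∀ t ∈ T, ∫ y, F t y ∂(ProbabilityTheory.stdGaussian E) ≤ a t) {l : ℝ} (hl : 0 < l) :
    ∫ x, T.sup' hT (fun t => F t x) ∂(ProbabilityTheory.stdGaussian E)
      ≤ T.sup' hT a + (Real.log T.card / l + l * (Real.pi ^ 2 * K ^ 2 / 8)) := by
  have key := integral_sup'_sub_le hT hF hl
  set γ := ProbabilityTheory.stdGaussian E
  have hL : ∀ c : ι → ℝ, LipschitzWith K (fun x => T.sup' hT fun t => F t x - c t) :=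
    fun c => LipschitzWith.finset_sup' hT fun t ht => by simpa using (hF t ht).sub (.const (c t))
  have h0 := hL 0
  simp only [Pi.zero_apply, sub_zero] at h0
  calc _ ≤ ∫ x, (T.sup' hT a + T.sup' hT fun t => F t x - ∫ y, F t y ∂γ) ∂γ := by
        refine integral_mono (integrable_of_lipschitz h0)
          ((integrable_const _).add (integrable_of_lipschitz (hL _))) fun x => ?_
        refine Finset.sup'_le _ _ fun t ht => ?_
        have h1 := Finset.le_sup' a ht
        have h2 := Finset.le_sup' (fun t => F t x - ∫ y, F t y ∂γ) ht
        have h3 := ha t ht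
        simp only at h2 ⊢
        linarith
    _ ≤ _ := by
        rw [integral_add (integrable_const _) (integrable_of_lipschitz (hL _)), integral_const,
          probReal_univ, one_smul]
        gcongr

end Concentration

section ScalarMoment

theorem integral_exp_mul_sq_gaussianReal {v : ℝ≥0} (hv : v ≠ 0) {b : ℝ} (hb : 2 * b * v < 1) :
    Integrable (fun z => Real.exp (b * z ^ 2)) (gaussianReal 0 v) ∧
      ∫ z, Real.exp (b * z ^ 2) ∂(gaussianReal 0 v) = (Real.sqrt (1 - 2 * b * v))⁻¹ := by
  have hv' : (0 : ℝ) < v := by positivity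
  have hc : 0 < 1 / (2 * v) - b := by
    rw [sub_pos, lt_div_iff₀ (by positivity)]; linarith
  have hpt : ∀ z, gaussianPDFReal 0 v z • Real.exp (b * z ^ 2)
      = (Real.sqrt (2 * Real.pi * v))⁻¹ * Real.exp (-(1 / (2 * v) - b) * z ^ 2) := fun z => by
    rw [gaussianPDFReal, smul_eq_mul, mul_assoc, ← Real.exp_add]
    congr 2
    field_simp
    ring
  constructor
  · rw [gaussianReal_of_var_ne_zero _ hv, gaussianPDF_def,
      integrable_withDensity_iff_integrable_smul₀']
    · simp only [ENNReal.toReal_ofReal (gaussianPDFReal_nonneg 0 v _), hpt]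
      exact (integrable_exp_neg_mul_sq hc).const_mul _
    · exact (measurable_gaussianPDFReal 0 v).ennreal_ofReal.aemeasurable
    · exact ae_of_all _ fun _ => ENNReal.ofReal_lt_top
  · rw [integral_gaussianReal_eq_integral_smul hv]
    simp only [hpt]
    rw [integral_const_mul, integral_gaussian, ← Real.sqrt_inv, ← Real.sqrt_mul (by positivity),
      ← Real.sqrt_inv]
    congr 1
    have : 1 - 2 * b * v ≠ 0 := by linarith
    have h2 : 1 / (2 * (v : ℝ)) - b = (1 - 2 * b * v) / (2 * v) := by field_simp
    rw [h2]
    field_simp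

theorem inv_sqrt_one_sub_le_exp {w : ℝ} (h0 : 0 ≤ w) (h1 : w ≤ 1 / 2) :
    (Real.sqrt (1 - w))⁻¹ ≤ Real.exp w := by
  rw [← Real.sqrt_inv, Real.sqrt_le_left (Real.exp_pos _).le, ← Real.exp_nat_mul,
    inv_le_comm₀ (by linarith) (Real.exp_pos _), ← Real.exp_neg]
  have h2 : 2 * w + 1 ≤ Real.exp (2 * w) := Real.add_one_le_exp _
  rw [Real.exp_neg]
  push_cast
  rw [inv_le_comm₀ (Real.exp_pos _) (by linarith)]
  refine le_trans ?_ h2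
  rw [inv_le_iff_one_le_mul₀ (by linarith)]
  nlinarith

theorem integrable_abs_add_rpow_gaussianReal (v : ℝ≥0) {q : ℝ} (hq : 0 ≤ q) (x : ℝ) :
    Integrable (fun z => |x + z| ^ q) (gaussianReal 0 v) := by
  have h : MemLp (fun z => x + z) (ENNReal.ofReal q) (gaussianReal 0 v) :=
    (memLp_const x).add (memLp_id_gaussianReal' _ ENNReal.ofReal_ne_top)
  have := h.integrable_norm_rpow'
  simpa [ENNReal.toReal_ofReal hq] using this

theorem integral_abs_add_rpow_gaussianReal_le (v : ℝ≥0) {q : ℝ} (hq : 2 ≤ q) (x : ℝ) :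
    ∫ z, |x + z| ^ q ∂(gaussianReal 0 v) ≤ (x ^ 2 + 4 * q * v) ^ (q / 2) := by
  rcases eq_or_ne v 0 with rfl | hv
  · rw [gaussianReal_zero_var, integral_dirac, add_zero, NNReal.coe_zero, mul_zero, add_zero,
      ← sq_abs x, ← Real.rpow_natCast, ← Real.rpow_mul (abs_nonneg _)]
    apply le_of_eq
    congr 1
    push_cast
    ring
  have hv' : (0 : ℝ) < v := by positivity
  set a : ℝ := x ^ 2 + 4 * q * v with ha
  have ha0 : 0 < a := by positivity
  set α : ℝ := q * x / a
  set β : ℝ := q / (2 * a)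
  set M : ℝ := Real.exp (2 * q ^ 2 * v / a)
  have hpt : ∀ z, |x + z| ^ q ≤
      a ^ (q / 2) * M⁻¹ * ((Real.exp (2 * α * z) + Real.exp (2 * β * z ^ 2)) / 2) := fun z => by
    have h1 : |x + z| ^ 2 ≤ a * Real.exp ((2 * x * z + z ^ 2 - 4 * q * v) / a) := by
      have := Real.add_one_le_exp ((2 * x * z + z ^ 2 - 4 * q * v) / a)
      have h2 := mul_le_mul_of_nonneg_left this ha0.le
      refine le_trans (le_of_eq ?_) h2
      rw [sq_abs]
      field_simp
      rw [ha]; ring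
    have h2 : |x + z| ^ q = (|x + z| ^ 2) ^ (q / 2) := by
      rw [← Real.rpow_natCast, ← Real.rpow_mul (abs_nonneg _)]
      congr 1; push_cast; ring
    have h3 : Real.exp (α * z + β * z ^ 2) ≤
        (Real.exp (2 * α * z) + Real.exp (2 * β * z ^ 2)) / 2 := by
      rw [Real.exp_add, mul_assoc 2, mul_assoc 2, two_mul (α * z), two_mul (β * z ^ 2),
        Real.exp_add, Real.exp_add]
      nlinarith [sq_nonneg (Real.exp (α * z) - Real.exp (β * z ^ 2))]
    calc |x + z| ^ q ≤ (a * Real.exp ((2 * x * z + z ^ 2 - 4 * q * v) / a)) ^ (q / 2) := by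
          rw [h2]; gcongr
      _ = a ^ (q / 2) * M⁻¹ * Real.exp (α * z + β * z ^ 2) := by
          rw [Real.mul_rpow ha0.le (Real.exp_pos _).le, ← Real.exp_mul, ← Real.exp_neg,
            mul_assoc (a ^ (q / 2)), ← Real.exp_add]
          congr 2
          simp only [α, β]
          field_simp
          ring
      _ ≤ _ := by gcongr
  have hw : 2 * (2 * β) * v = 2 * q * v / a := by simp only [β]; field_simp
  have hw1 : 2 * q * v / a ≤ 1 / 2 := by
    rw [div_le_iff₀ ha0, ha]; nlinarith [sq_nonneg x]
  obtain ⟨hi2, he2⟩ := integral_exp_mul_sq_gaussianReal (b := 2 * β) hv (by linarith)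
  have hi1 : Integrable (fun z => Real.exp (2 * α * z)) (gaussianReal 0 v) :=
    integrable_exp_mul_gaussianReal _
  have he1 : ∫ z, Real.exp (2 * α * z) ∂(gaussianReal 0 v) ≤ M := by
    have := congrFun (mgf_id_gaussianReal (μ := 0) (v := v)) (2 * α)
    simp only [mgf, id] at this
    rw [this]
    refine Real.exp_le_exp.2 ?_
    have hxa : x ^ 2 ≤ a := by rw [ha]; nlinarith
    calc 0 * (2 * α) + v * (2 * α) ^ 2 / 2 = 2 * q ^ 2 * v * x ^ 2 / a / a := by
          simp only [α]; field_simp; ring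
      _ ≤ 2 * q ^ 2 * v * a / a / a := by gcongr
      _ = _ := by field_simp
  have he3 : ∫ z, Real.exp (2 * β * z ^ 2) ∂(gaussianReal 0 v) ≤ M := by
    rw [he2, hw]
    refine (inv_sqrt_one_sub_le_exp (by positivity) hw1).trans (Real.exp_le_exp.2 ?_)
    have : q ≤ q ^ 2 := by nlinarith
    gcongr
  calc _ ≤ ∫ z, a ^ (q / 2) * M⁻¹ * ((Real.exp (2 * α * z) + Real.exp (2 * β * z ^ 2)) / 2)
        ∂(gaussianReal 0 v) :=
        integral_mono (integrable_abs_add_rpow_gaussianReal v (by linarith) x)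
          (((hi1.add hi2).div_const 2).const_mul _) hpt
    _ = a ^ (q / 2) * M⁻¹ * ((∫ z, Real.exp (2 * α * z) ∂(gaussianReal 0 v) +
        ∫ z, Real.exp (2 * β * z ^ 2) ∂(gaussianReal 0 v)) / 2) := by
        rw [integral_const_mul, integral_div, integral_add hi1 hi2]
    _ ≤ a ^ (q / 2) * M⁻¹ * ((M + M) / 2) := by gcongr
    _ = _ := by
        have : M ≠ 0 := (Real.exp_pos _).ne'
        field_simp
        ring

end ScalarMoment

section Conditional

theorem PiLp.norm_rpow_toReal_eq_sum {ι : Type*} [Fintype ι] {q : ℝ≥0∞} [Fact (1 ≤ q)]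
    (hq : 0 < q.toReal) (x : PiLp q fun _ : ι => ℝ) :
    ‖x‖ ^ q.toReal = ∑ i, |x i| ^ q.toReal := by
  rw [PiLp.norm_eq_sum hq, one_div, Real.rpow_inv_rpow (by positivity) hq.ne']
  rfl

theorem sq_integral_le {Ω : Type*} [MeasurableSpace Ω] {μ : Measure Ω} [IsProbabilityMeasure μ]
    {f : Ω → ℝ} (hf : Integrable f μ) (hf2 : Integrable (fun x => f x ^ 2) μ) :
    (∫ x, f x ∂μ) ^ 2 ≤ ∫ x, f x ^ 2 ∂μ :=
  (even_two.convexOn_pow (𝕜 := ℝ)).map_integral_le (continuous_pow 2).continuousOn isClosed_univ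
    (by simp) hf hf2

theorem rpow_integral_le {Ω : Type*} [MeasurableSpace Ω] {μ : Measure Ω} [IsProbabilityMeasure μ]
    {f : Ω → ℝ} {r : ℝ} (hr : 1 ≤ r) (h0 : ∀ x, 0 ≤ f x) (hf : Integrable f μ)
    (hfr : Integrable (fun x => f x ^ r) μ) :
    (∫ x, f x ∂μ) ^ r ≤ ∫ x, f x ^ r ∂μ :=
  (convexOn_rpow hr).map_integral_le
    (Real.continuous_rpow_const (by linarith)).continuousOn isClosed_Ici
    (ae_of_all _ h0) hf hfr

theorem integral_sqrt_norm_add_dual_le {E : Type*} [NormedAddCommGroup E] [InnerProductSpace ℝ E]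
    [FiniteDimensional ℝ E] [MeasurableSpace E] [BorelSpace E] {ι : Type*} [Fintype ι]
    {q : ℝ≥0∞} [Fact (1 ≤ q)] (hq : 2 ≤ q.toReal) (x : ι → ℝ) (L : ι → StrongDual ℝ E) (c : ℝ) :
    ∫ h, Real.sqrt (‖(WithLp.toLp q fun i => x i + L i h : PiLp q fun _ : ι => ℝ)‖ ^ 2 + c ^ 2)
        ∂(ProbabilityTheory.stdGaussian E)
      ≤ Real.sqrt ((∑ i, (x i ^ 2 + 4 * q.toReal * ‖L i‖ ^ 2) ^ (q.toReal / 2)) ^ (2 / q.toReal)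
        + c ^ 2) := by
  set γ := ProbabilityTheory.stdGaussian E
  set r := q.toReal with hr
  have hr0 : 0 < r := by linarith
  set y : E → PiLp q fun _ : ι => ℝ := fun h => WithLp.toLp q fun i => x i + L i h with hy
  have hyc : Continuous y := (PiLp.continuous_toLp q _).comp (by fun_prop)
  have hcoord : ∀ i, Integrable (fun h => |x i + L i h| ^ r) γ ∧
      ∫ h, |x i + L i h| ^ r ∂γ ≤ (x i ^ 2 + 4 * r * ‖L i‖ ^ 2) ^ (r / 2) := fun i => by
    have hmap := map_dual_stdGaussian (L i)
    have hcont : Continuous fun z : ℝ => |x i + z| ^ r :=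
      (by fun_prop : Continuous fun z : ℝ => |x i + z|).rpow_const fun _ => Or.inr hr0.le
    constructor
    · refine (integrable_map_measure (μ := γ) (f := L i) (g := fun z => |x i + z| ^ r)
        hcont.aestronglyMeasurable (by fun_prop)).1 ?_
      rw [hmap]
      exact integrable_abs_add_rpow_gaussianReal _ hr0.le _
    · have h2 := integral_map (μ := γ) (φ := L i) (f := fun z => |x i + z| ^ r) (by fun_prop)
        hcont.aestronglyMeasurable
      rw [← h2, hmap]
      have h3 := integral_abs_add_rpow_gaussianReal_le (‖L i‖₊ ^ 2) hq (x i)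
      rwa [NNReal.coe_pow, coe_nnnorm] at h3
  have hnr : ∀ h, ‖y h‖ ^ r = ∑ i, |x i + L i h| ^ r := fun h =>
    PiLp.norm_rpow_toReal_eq_sum hr0 _
  have hir : Integrable (fun h => ‖y h‖ ^ r) γ := by
    simp only [hnr]
    exact integrable_finsetSum _ fun i _ => (hcoord i).1
  have hpow : ∀ h, (‖y h‖ ^ 2) ^ (r / 2) = ‖y h‖ ^ r := fun h => by
    rw [← Real.rpow_natCast, ← Real.rpow_mul (norm_nonneg _)]
    congr 1; push_cast; ring
  have hi2 : Integrable (fun h => ‖y h‖ ^ 2) γ := by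
    refine Integrable.mono' ((integrable_const (1 : ℝ)).add hir)
      (by fun_prop) (ae_of_all _ fun h => ?_)
    rw [Real.norm_eq_abs, abs_of_nonneg (by positivity)]
    rcases le_total (‖y h‖) 1 with h1 | h1
    · have : ‖y h‖ ^ 2 ≤ 1 := pow_le_one₀ (norm_nonneg _) h1
      have h3 : 0 ≤ ‖y h‖ ^ r := by positivity
      simp only [Pi.add_apply]
      linarith
    · have : ‖y h‖ ^ (2 : ℝ) ≤ ‖y h‖ ^ r := Real.rpow_le_rpow_of_exponent_le h1 hq
      rw [Real.rpow_two] at this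
      simp only [Pi.add_apply]
      linarith
  have hi2c : Integrable (fun h => ‖y h‖ ^ 2 + c ^ 2) γ := hi2.add (integrable_const _)
  have hsq : ∀ h, Real.sqrt (‖y h‖ ^ 2 + c ^ 2) ^ 2 = ‖y h‖ ^ 2 + c ^ 2 := fun h =>
    Real.sq_sqrt (by positivity)
  have hi1 : Integrable (fun h => Real.sqrt (‖y h‖ ^ 2 + c ^ 2)) γ := by
    refine Integrable.mono' ((integrable_const (1 : ℝ)).add hi2c)
      (by fun_prop) (ae_of_all _ fun h => ?_)
    rw [Real.norm_eq_abs, abs_of_nonneg (by positivity)]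
    simp only [Pi.add_apply]
    nlinarith [hsq h, sq_nonneg (Real.sqrt (‖y h‖ ^ 2 + c ^ 2) - 1 / 2)]
  refine Real.le_sqrt_of_sq_le ?_
  refine (sq_integral_le hi1 (by simpa only [hsq] using hi2c)).trans ?_
  simp only [hsq]
  rw [integral_add hi2 (integrable_const _), integral_const, probReal_univ, one_smul]
  gcongr
  have hJ := rpow_integral_le (μ := γ) (f := fun h => ‖y h‖ ^ 2) (r := r / 2) (by linarith)
    (fun _ => by positivity) hi2 (by simpa only [hpow] using hir)
  simp only [hpow] at hJ
  have hsum : ∫ h, ‖y h‖ ^ r ∂γ ≤ ∑ i, (x i ^ 2 + 4 * r * ‖L i‖ ^ 2) ^ (r / 2) := by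
    simp only [hnr]
    rw [integral_finsetSum _ fun i _ => (hcoord i).1]
    exact Finset.sum_le_sum fun i _ => (hcoord i).2
  have h0 : 0 ≤ ∫ h, ‖y h‖ ^ 2 ∂γ := integral_nonneg fun _ => by positivity
  calc _ = ((∫ h, ‖y h‖ ^ 2 ∂γ) ^ (r / 2)) ^ (2 / r) := by
        rw [← Real.rpow_mul h0, div_mul_div_cancel₀ (two_ne_zero), div_self hr0.ne', Real.rpow_one]
    _ ≤ _ := by
        gcongr
        exact hJ.trans hsum

theorem rpow_sum_sq_add_le {ι κ : Type*} [Fintype ι] {q : ℝ≥0∞} [Fact (1 ≤ q)] (hq2 : 2 ≤ q)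
    (hq : q ≠ ⊤) (x : ι → ℝ) (s : Finset κ) {w : κ → ℝ} (hw : ∀ j, 0 ≤ w j) (a : ι → κ → ℝ) :
    (∑ i, (x i ^ 2 + ∑ j ∈ s, w j * a i j ^ 2) ^ (q.toReal / 2)) ^ (2 / q.toReal)
      ≤ ‖(WithLp.toLp q x : PiLp q fun _ : ι => ℝ)‖ ^ 2 +
        ∑ j ∈ s, w j * ‖(WithLp.toLp q fun i => a i j : PiLp q fun _ : ι => ℝ)‖ ^ 2 := by
  have hqr : 2 ≤ q.toReal := by simpa using ENNReal.toReal_mono hq hq2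
  have hr2 : (q / 2).toReal = q.toReal / 2 := by simp
  have : Fact (1 ≤ q / 2) := ⟨by
    rw [ENNReal.le_div_iff_mul_le (by simp) (by simp)]; simpa using hq2⟩
  have hn : ∀ z : ι → ℝ, (∀ i, 0 ≤ z i) →
      ‖(WithLp.toLp (q / 2) z : PiLp (q / 2) fun _ : ι => ℝ)‖
        = (∑ i, z i ^ (q.toReal / 2)) ^ (2 / q.toReal) := fun z hz => by
    rw [PiLp.norm_eq_sum (by rw [hr2]; linarith), hr2, one_div_div]
    simp only [Real.norm_eq_abs, abs_of_nonneg (hz _)]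
  have hsq : ∀ z : ι → ℝ, ‖(WithLp.toLp (q / 2) (fun i => z i ^ 2) : PiLp (q / 2) fun _ : ι => ℝ)‖
      = ‖(WithLp.toLp q z : PiLp q fun _ : ι => ℝ)‖ ^ 2 := fun z => by
    rw [hn _ fun i => sq_nonneg _, PiLp.norm_eq_sum (by linarith), ← Real.rpow_natCast,
      ← Real.rpow_mul (Finset.sum_nonneg fun _ _ => by positivity)]
    congr 1
    · refine Finset.sum_congr rfl fun i _ => ?_
      rw [← sq_abs, ← Real.rpow_natCast, ← Real.rpow_mul (abs_nonneg _)]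
      simp only [Real.norm_eq_abs]
      congr 1
      push_cast; ring
    · push_cast; ring
  rw [← hn _ fun i => add_nonneg (sq_nonneg _) (Finset.sum_nonneg fun j _ =>
    mul_nonneg (hw j) (sq_nonneg _))]
  have hdec : (WithLp.toLp (q / 2) fun i => x i ^ 2 + ∑ j ∈ s, w j * a i j ^ 2 :
      PiLp (q / 2) fun _ : ι => ℝ) = (WithLp.toLp (q / 2) fun i => x i ^ 2) +
        ∑ j ∈ s, w j • (WithLp.toLp (q / 2) fun i => a i j ^ 2) := by
    ext i
    simp [WithLp.ofLp_sum]
  rw [hdec]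
  refine (norm_add_le _ _).trans (add_le_add (hsq x).le ?_)
  refine (norm_sum_le _ _).trans (Finset.sum_le_sum fun j _ => ?_)
  rw [norm_smul, Real.norm_eq_abs, abs_of_nonneg (hw j), hsq]

end Conditional

section Mixing

variable {ι κ : Type*} [Fintype ι] [Fintype κ]

instance isProbabilityMeasure_pi_gaussianReal : IsProbabilityMeasure (_root_.stdGaussian ι) := by
  unfold _root_.stdGaussian; infer_instance

theorem measurePreserving_ite_pi {α : ι → Type*} [∀ i, MeasurableSpace (α i)]
    (μ : ∀ i, Measure (α i)) [∀ i, IsProbabilityMeasure (μ i)] (s : ι → Prop) [DecidablePred s] :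
    MeasurePreserving (fun (p : (∀ i, α i) × ∀ i, α i) i => if s i then p.2 i else p.1 i)
      ((Measure.pi μ).prod (Measure.pi μ)) (Measure.pi μ) := by
  have hm : Measurable fun (p : (∀ i, α i) × ∀ i, α i) i => if s i then p.2 i else p.1 i := by
    refine measurable_pi_lambda _ fun i => ?_
    split_ifs <;> fun_prop
  refine ⟨hm, (Measure.pi_eq fun B hB => ?_).symm⟩
  rw [Measure.map_apply hm (MeasurableSet.univ_pi hB)]
  have hpre : (fun (p : (∀ i, α i) × ∀ i, α i) i => if s i then p.2 i else p.1 i) ⁻¹'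
      Set.univ.pi B = (Set.univ.pi fun i => if s i then Set.univ else B i) ×ˢ
        (Set.univ.pi fun i => if s i then B i else Set.univ) := by
    ext p
    simp only [Set.mem_preimage, Set.mem_univ_pi, Set.mem_prod, ← forall_and]
    refine forall_congr' fun i => ?_
    split_ifs <;> simp
  rw [hpre, Measure.prod_prod, Measure.pi_pi, Measure.pi_pi, ← Finset.prod_mul_distrib]
  refine Finset.prod_congr rfl fun i _ => ?_
  split_ifs <;> simp

theorem measurePreserving_ofLp_stdGaussian :
    MeasurePreserving (WithLp.ofLp : EuclideanSpace ℝ ι → ι → ℝ)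
      (ProbabilityTheory.stdGaussian (EuclideanSpace ℝ ι)) (_root_.stdGaussian ι) := by
  refine ⟨by fun_prop, ?_⟩
  rw [← map_pi_eq_stdGaussian, Measure.map_map (by fun_prop) (by fun_prop)]
  exact Measure.map_id

end Mixing

section ColumnSplit

variable {ι κ : Type*} [Fintype ι] [Fintype κ] [DecidableEq κ]

/-- The vector whose norm interpolates between `‖G_A t‖_q` (when `S` is everything) and `c * ‖t‖₂`
(when `S` is empty). -/
def splitVec (q : ℝ≥0∞) (c : ℝ) (A : ι → κ → ℝ) (S : Finset κ) (g : ι × κ → ℝ)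
    (t : EuclideanSpace ℝ κ) : WithLp 2 (PiLp q (fun _ : ι => ℝ) × EuclideanSpace ℝ κ) :=
  WithLp.toLp 2 (WithLp.toLp q fun i => ∑ j ∈ S, A i j * g (i, j) * t j,
    WithLp.toLp 2 fun j => if j ∈ S then 0 else c * t j)

variable {q : ℝ≥0∞} [Fact (1 ≤ q)] {c : ℝ} {A : ι → κ → ℝ} {S J : Finset κ}

theorem norm_splitVec (g : ι × κ → ℝ) (t : EuclideanSpace ℝ κ) :
    ‖splitVec q c A S g t‖ = Real.sqrt (‖(WithLp.toLp q fun i => ∑ j ∈ S, A i j * g (i, j) * t j :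
      PiLp q fun _ : ι => ℝ)‖ ^ 2 + c ^ 2 * ∑ j ∈ Sᶜ, t j ^ 2) := by
  rw [eq_comm, Real.sqrt_eq_iff_mul_self_eq (by positivity) (norm_nonneg _), ← sq,
    WithLp.prod_norm_sq_eq_of_L2, EuclideanSpace.norm_sq_eq]
  simp only [splitVec]
  congr 1
  rw [Finset.mul_sum]
  refine Finset.sum_subset_zero_on_sdiff (Finset.subset_univ _) (fun j hj => ?_) fun j hj => ?_
  · simp only [Finset.mem_sdiff, Finset.mem_univ, true_and, Finset.mem_compl, not_not] at hj
    simp [hj]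
  · rw [Finset.mem_compl] at hj
    simp [hj, mul_pow]

omit [Fintype ι] [Fintype κ] [Fact (1 ≤ q)] in
theorem continuous_splitVec (t : EuclideanSpace ℝ κ) :
    Continuous fun g => splitVec q c A S g t := by
  unfold splitVec
  refine (WithLp.prod_continuous_toLp 2 _ _).comp (Continuous.prodMk ?_ continuous_const)
  exact (PiLp.continuous_toLp q _).comp (by fun_prop)

theorem PiLp.norm_toLp_le_of_two_le {q : ℝ≥0∞} [Fact (1 ≤ q)] (hq2 : 2 ≤ q) (hq : q ≠ ⊤)
    (x : ι → ℝ) : ‖(WithLp.toLp q x : PiLp q fun _ : ι => ℝ)‖ ^ 2 ≤ ∑ i, x i ^ 2 := by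
  have hqr : 2 ≤ q.toReal := by simpa using ENNReal.toReal_mono hq hq2
  set N := ‖(WithLp.toLp q x : PiLp q fun _ : ι => ℝ)‖
  set M := Real.sqrt (∑ i, x i ^ 2)
  have hs : 0 ≤ ∑ i, x i ^ 2 := Finset.sum_nonneg fun _ _ => sq_nonneg _
  have hM : M ^ 2 = ∑ i, x i ^ 2 := Real.sq_sqrt hs
  have hM0 : 0 ≤ M := Real.sqrt_nonneg _
  rw [← hM]
  have hxM : ∀ i, |x i| ≤ M := fun i => by
    rw [← Real.sqrt_sq_eq_abs]
    exact Real.sqrt_le_sqrt (Finset.single_le_sum (f := fun i => x i ^ 2)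
      (fun _ _ => sq_nonneg _) (Finset.mem_univ i))
  have hN : N ^ q.toReal ≤ M ^ q.toReal := by
    rw [PiLp.norm_rpow_toReal_eq_sum (by linarith)]
    calc ∑ i, |x i| ^ q.toReal ≤ ∑ i, x i ^ 2 * M ^ (q.toReal - 2) := by
          refine Finset.sum_le_sum fun i _ => ?_
          rcases eq_or_ne (x i) 0 with h0 | h0
          · rw [h0, abs_zero, Real.zero_rpow (by linarith)]; simp
          · have h1 : |x i| ^ q.toReal = |x i| ^ (2 : ℝ) * |x i| ^ (q.toReal - 2) := by
              rw [← Real.rpow_add (abs_pos.2 h0)]; congr 1; ring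
            rw [h1, Real.rpow_two, sq_abs]
            gcongr
            exact hxM i
      _ = M ^ q.toReal := by
          rw [← Finset.sum_mul, ← hM]
          rcases hM0.eq_or_lt with h0 | h0
          · rw [← h0, Real.zero_rpow (by linarith : q.toReal ≠ 0)]; simp
          · rw [← Real.rpow_two, ← Real.rpow_add h0]; congr 1; ring
  have := (Real.rpow_le_rpow_iff (norm_nonneg _) hM0 (by linarith)).1 hN
  gcongr

omit [Fintype ι] [Fintype κ] in
theorem sum_union_ite (hSJ : Disjoint S J) (g h : ι × κ → ℝ) (t : κ → ℝ) (i : ι) :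
    ∑ j ∈ S ∪ J, A i j * (if j ∈ J then h (i, j) else g (i, j)) * t j
      = ∑ j ∈ S, A i j * g (i, j) * t j + ∑ j ∈ J, A i j * h (i, j) * t j := by
  rw [Finset.sum_union hSJ]
  congr 1
  · refine Finset.sum_congr rfl fun j hj => ?_
    rw [if_neg (Finset.disjoint_left.1 hSJ hj)]
  · refine Finset.sum_congr rfl fun j hj => ?_
    rw [if_pos hj]

theorem lipschitzWith_norm_splitVec_mix (hq2 : 2 ≤ q) (hq : q ≠ ⊤) (hSJ : Disjoint S J) {b : ℝ≥0}
    (hb : ∀ i, ∀ j ∈ J, |A i j| ≤ b) (g : ι × κ → ℝ) {t : EuclideanSpace ℝ κ} (ht : ‖t‖ ≤ 1) :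
    LipschitzWith b fun h : EuclideanSpace ℝ (ι × κ) =>
      ‖splitVec q c A (S ∪ J) (fun p => if p.2 ∈ J then h p else g p) t‖ := by
  refine LipschitzWith.of_dist_le_mul fun h h' => ?_
  rw [Real.dist_eq, dist_eq_norm]
  refine (abs_norm_sub_norm_le _ _).trans ?_
  refine abs_le_of_sq_le_sq' ?_ (by positivity) |>.2
  have ht1 : ∑ j, t j ^ 2 ≤ 1 := by
    have : ‖t‖ ^ 2 ≤ 1 := pow_le_one₀ (norm_nonneg _) ht
    simpa [EuclideanSpace.norm_sq_eq] using this
  have hdiff : ‖splitVec q c A (S ∪ J) (fun p => if p.2 ∈ J then h p else g p) t -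
      splitVec q c A (S ∪ J) (fun p => if p.2 ∈ J then h' p else g p) t‖ ^ 2
      = ‖(WithLp.toLp q fun i => ∑ j ∈ J, A i j * (h - h') (i, j) * t j :
        PiLp q fun _ : ι => ℝ)‖ ^ 2 := by
    rw [WithLp.prod_norm_sq_eq_of_L2]
    have h2 : (splitVec q c A (S ∪ J) (fun p => if p.2 ∈ J then h p else g p) t -
      splitVec q c A (S ∪ J) (fun p => if p.2 ∈ J then h' p else g p) t).snd = 0 := by
      simp [splitVec]
    have h1 : (splitVec q c A (S ∪ J) (fun p => if p.2 ∈ J then h p else g p) t -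
      splitVec q c A (S ∪ J) (fun p => if p.2 ∈ J then h' p else g p) t).fst =
        WithLp.toLp q fun i => ∑ j ∈ J, A i j * (h - h') (i, j) * t j := by
      ext i
      simp only [splitVec, WithLp.sub_fst, PiLp.sub_apply, sum_union_ite hSJ]
      change (_ + _) - (_ + _) = _
      rw [add_sub_add_left_eq_sub, ← Finset.sum_sub_distrib]
      refine Finset.sum_congr rfl fun j _ => by ring
    rw [h1, h2, norm_zero]
    ring
  rw [hdiff]
  refine (PiLp.norm_toLp_le_of_two_le hq2 hq _).trans ?_
  rw [mul_pow, EuclideanSpace.norm_sq_eq, Finset.mul_sum, Fintype.sum_prod_type]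
  refine Finset.sum_le_sum fun i _ => ?_
  calc (∑ j ∈ J, A i j * (h - h') (i, j) * t j) ^ 2
      ≤ (∑ j ∈ J, (A i j * (h - h') (i, j)) ^ 2) * ∑ j ∈ J, t j ^ 2 :=
        Finset.sum_mul_sq_le_sq_mul_sq _ _ _
    _ ≤ (∑ j ∈ J, (A i j * (h - h') (i, j)) ^ 2) * 1 := by
        gcongr
        exact (Finset.sum_le_univ_sum_of_nonneg fun _ => sq_nonneg _).trans ht1
    _ ≤ ∑ j ∈ J, b ^ 2 * ‖(h - h') (i, j)‖ ^ 2 := by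
        rw [mul_one]
        refine Finset.sum_le_sum fun j hj => ?_
        rw [mul_pow, Real.norm_eq_abs, sq_abs, ← sq_abs (A i j)]
        have := hb i j hj
        gcongr
    _ ≤ _ := Finset.sum_le_univ_sum_of_nonneg fun _ => by positivity

theorem integral_norm_splitVec_mix_le (hq2 : 2 ≤ q) (hq : q ≠ ⊤) (hSJ : Disjoint S J)
    (hc : ∀ j ∈ J, 4 * q.toReal * ‖(WithLp.toLp q fun i => A i j : PiLp q fun _ : ι => ℝ)‖ ^ 2
      ≤ c ^ 2) (g : ι × κ → ℝ) (t : EuclideanSpace ℝ κ) :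
    ∫ h : EuclideanSpace ℝ (ι × κ),
      ‖splitVec q c A (S ∪ J) (fun p => if p.2 ∈ J then h p else g p) t‖
        ∂(ProbabilityTheory.stdGaussian (EuclideanSpace ℝ (ι × κ)))
      ≤ ‖splitVec q c A S g t‖ := by
  have hqr : 2 ≤ q.toReal := by simpa using ENNReal.toReal_mono hq hq2
  classical
  set v : ι → EuclideanSpace ℝ (ι × κ) := fun i =>
    WithLp.toLp 2 fun p => if p.1 = i ∧ p.2 ∈ J then A i p.2 * t p.2 else 0 with hv
  set x : ι → ℝ := fun i => ∑ j ∈ S, A i j * g (i, j) * t j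
  set d : ℝ := Real.sqrt (c ^ 2 * ∑ j ∈ (S ∪ J)ᶜ, t j ^ 2)
  have hd : d ^ 2 = c ^ 2 * ∑ j ∈ (S ∪ J)ᶜ, t j ^ 2 := Real.sq_sqrt (by positivity)
  have hinner : ∀ i (h : EuclideanSpace ℝ (ι × κ)),
      (innerSL ℝ (v i)) h = ∑ j ∈ J, A i j * h (i, j) * t j := fun i h => by
    rw [innerSL_apply_apply, PiLp.inner_apply, Fintype.sum_prod_type, Finset.sum_eq_single i]
    · simp only [hv, true_and]
      rw [← Finset.sum_subset (Finset.subset_univ J)]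
      · refine Finset.sum_congr rfl fun j hj => ?_
        simp [hj]; ring
      · intro j _ hj
        simp [hj]
    · intro i' _ hi'
      simp [hv, hi']
    · simp
  have hnorm : ∀ i, ‖innerSL ℝ (v i)‖ ^ 2 = ∑ j ∈ J, t j ^ 2 * A i j ^ 2 := fun i => by
    rw [innerSL_apply_norm, EuclideanSpace.norm_sq_eq, Fintype.sum_prod_type,
      Finset.sum_eq_single i]
    · simp only [hv, true_and]
      rw [← Finset.sum_subset (Finset.subset_univ J)]
      · refine Finset.sum_congr rfl fun j hj => ?_
        simp [hj, mul_pow]; ring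
      · intro j _ hj
        simp [hj]
    · intro i' _ hi'
      simp [hv, hi']
    · simp
  have hpt : ∀ h : EuclideanSpace ℝ (ι × κ),
      ‖splitVec q c A (S ∪ J) (fun p => if p.2 ∈ J then h p else g p) t‖ =
        Real.sqrt (‖(WithLp.toLp q fun i => x i + innerSL ℝ (v i) h :
          PiLp q fun _ : ι => ℝ)‖ ^ 2 + d ^ 2) := fun h => by
    rw [norm_splitVec, hd]
    simp only [sum_union_ite hSJ, hinner, x]
  simp only [hpt]
  refine (integral_sqrt_norm_add_dual_le hqr x (fun i => innerSL ℝ (v i)) d).trans ?_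
  rw [norm_splitVec]
  refine Real.sqrt_le_sqrt ?_
  have hmink := rpow_sum_sq_add_le hq2 hq x J (w := fun j => 4 * q.toReal * t j ^ 2)
    (fun j => by positivity) A
  simp only [hnorm, Finset.mul_sum (s := J) (a := 4 * q.toReal), ← mul_assoc]
  rw [hd]
  have hcompl : ∑ j ∈ Sᶜ, t j ^ 2 = ∑ j ∈ J, t j ^ 2 + ∑ j ∈ (S ∪ J)ᶜ, t j ^ 2 := by
    rw [← Finset.sum_union]
    · congr 1
      ext j
      have hdisj : j ∈ S → j ∉ J := fun h => Finset.disjoint_left.1 hSJ h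
      simp only [Finset.mem_compl, Finset.mem_union]
      tauto
    · refine Finset.disjoint_left.2 fun j hj hj' => ?_
      simp [hj] at hj'
  rw [hcompl, mul_add, ← add_assoc]
  gcongr
  refine hmink.trans ?_
  rw [Finset.mul_sum]
  refine add_le_add le_rfl (Finset.sum_le_sum fun j hj => ?_)
  have := mul_le_mul_of_nonneg_left (hc j hj) (sq_nonneg (t j))
  linarith

theorem lipschitzWith_norm_splitVec (hq2 : 2 ≤ q) (hq : q ≠ ⊤) {b : ℝ≥0}
    (hb : ∀ i j, |A i j| ≤ b) {t : EuclideanSpace ℝ κ} (ht : ‖t‖ ≤ 1) :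
    LipschitzWith b fun g : EuclideanSpace ℝ (ι × κ) => ‖splitVec q c A S g t‖ := by
  have h := lipschitzWith_norm_splitVec_mix (c := c) hq2 hq (Finset.disjoint_empty_left S)
    (fun i j _ => hb i j) 0 ht
  convert h using 3 with g
  simp only [splitVec, Finset.empty_union]
  congr 3
  ext i
  exact Finset.sum_congr rfl fun j hj => by simp [hj]

theorem integrable_sup'_norm_splitVec (hq2 : 2 ≤ q) (hq : q ≠ ⊤)
    {T : Finset (EuclideanSpace ℝ κ)} (hT : T.Nonempty) (hball : ∀ t ∈ T, ‖t‖ ≤ 1) :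
    Integrable (fun g => T.sup' hT fun t => ‖splitVec q c A S g t‖)
      (_root_.stdGaussian (ι × κ)) := by
  have hcont : Continuous fun g => T.sup' hT fun t => ‖splitVec q c A S g t‖ :=
    Continuous.finset_sup'_apply _ fun t _ => (continuous_splitVec t).norm
  obtain ⟨b, hb⟩ : ∃ b : ℝ≥0, ∀ i j, |A i j| ≤ b := by
    refine ⟨∑ i, ∑ j, ‖A i j‖₊, fun i j => ?_⟩
    have h1 : ‖A i j‖₊ ≤ ∑ j, ‖A i j‖₊ :=
      Finset.single_le_sum (f := fun j => ‖A i j‖₊) (fun _ _ => zero_le) (Finset.mem_univ j)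
    have h2 : ∑ j, ‖A i j‖₊ ≤ ∑ i, ∑ j, ‖A i j‖₊ :=
      Finset.single_le_sum (f := fun i => ∑ j, ‖A i j‖₊) (fun _ _ => zero_le) (Finset.mem_univ i)
    exact_mod_cast h1.trans h2
  refine (measurePreserving_ofLp_stdGaussian.integrable_comp
    hcont.aestronglyMeasurable).1 ?_
  exact integrable_of_lipschitz (LipschitzWith.finset_sup' hT fun t ht =>
    lipschitzWith_norm_splitVec hq2 hq hb (hball t ht))

theorem integral_sup'_norm_splitVec_union_le (hq2 : 2 ≤ q) (hq : q ≠ ⊤) (hSJ : Disjoint S J)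
    {b : ℝ≥0} (hb : ∀ i, ∀ j ∈ J, |A i j| ≤ b)
    (hc : ∀ j ∈ J, 4 * q.toReal * ‖(WithLp.toLp q fun i => A i j : PiLp q fun _ : ι => ℝ)‖ ^ 2
      ≤ c ^ 2) {T : Finset (EuclideanSpace ℝ κ)} (hT : T.Nonempty) (hball : ∀ t ∈ T, ‖t‖ ≤ 1)
    {l : ℝ} (hl : 0 < l) :
    ∫ g, T.sup' hT (fun t => ‖splitVec q c A (S ∪ J) g t‖) ∂(_root_.stdGaussian (ι × κ))
      ≤ ∫ g, T.sup' hT (fun t => ‖splitVec q c A S g t‖) ∂(_root_.stdGaussian (ι × κ))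
        + (Real.log T.card / l + l * (Real.pi ^ 2 * b ^ 2 / 8)) := by
  set γ := _root_.stdGaussian (ι × κ) with hγ
  set β := Real.log T.card / l + l * (Real.pi ^ 2 * b ^ 2 / 8)
  have hmix : MeasurePreserving (fun (p : (ι × κ → ℝ) × (ι × κ → ℝ)) i =>
      if i.2 ∈ J then p.2 i else p.1 i) (γ.prod γ) γ :=
    measurePreserving_ite_pi (fun _ => gaussianReal 0 1) fun i : ι × κ => i.2 ∈ J
  set H : (ι × κ → ℝ) → ℝ := fun g => T.sup' hT fun t => ‖splitVec q c A (S ∪ J) g t‖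
  have hH : Continuous H :=
    Continuous.finset_sup'_apply _ fun t _ => (continuous_splitVec t).norm
  have hHi : Integrable H γ := integrable_sup'_norm_splitVec hq2 hq hT hball
  have hHmix := (hmix.integrable_comp hH.aestronglyMeasurable).2 hHi
  rw [← hmix.map_eq, integral_map hmix.aemeasurable hH.aestronglyMeasurable, hmix.map_eq]
  refine (integral_prod _ hHmix).trans_le ?_
  have hSi : Integrable (fun g => T.sup' hT fun t => ‖splitVec q c A S g t‖) γ :=
    integrable_sup'_norm_splitVec hq2 hq hT hball
  calc _ ≤ ∫ g, (T.sup' hT (fun t => ‖splitVec q c A S g t‖) + β) ∂γ := by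
        refine integral_mono hHmix.integral_prod_left (hSi.add (integrable_const _)) fun g => ?_
        have hm := measurePreserving_ofLp_stdGaussian (ι := ι × κ)
        have hHg : Continuous fun h : ι × κ → ℝ => H fun i => if i.2 ∈ J then h i else g i := by
          refine hH.comp (continuous_pi fun i => ?_)
          split_ifs <;> fun_prop
        change ∫ h, H (fun i => if i.2 ∈ J then h i else g i) ∂γ ≤ _
        rw [hγ, ← hm.map_eq, integral_map hm.aemeasurable hHg.aestronglyMeasurable]
        exact integral_sup'_le hT
          (fun t ht => lipschitzWith_norm_splitVec_mix hq2 hq hSJ hb g (hball t ht))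
          (fun t _ => integral_norm_splitVec_mix_le hq2 hq hSJ hc g t) hl
    _ = _ := by rw [integral_add hSi (integrable_const _), integral_const, probReal_univ, one_smul]

end ColumnSplit

section Nets

open scoped Function in
theorem card_le_of_separated_unitBall {V : Type*} [NormedAddCommGroup V] [NormedSpace ℝ V]
    [FiniteDimensional ℝ V] {ε : ℝ} (hε : 0 < ε) (s : Finset V) (hs : ∀ x ∈ s, ‖x‖ ≤ 1)
    (h : ∀ x ∈ s, ∀ y ∈ s, x ≠ y → ε ≤ ‖x - y‖) :
    (s.card : ℝ) ≤ (1 + 2 / ε) ^ Module.finrank ℝ V := by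
  borelize V
  let μ : Measure V := Measure.addHaar
  set d := Module.finrank ℝ V
  have hdisj : Set.Pairwise (s : Set V) (Disjoint on fun x => Metric.ball (x : V) (ε / 2)) := by
    rintro x hx y hy hxy
    apply Metric.ball_disjoint_ball
    rw [dist_eq_norm, add_halves]
    exact h x hx y hy hxy
  have hsub : (⋃ x ∈ s, Metric.ball (x : V) (ε / 2)) ⊆ Metric.ball (0 : V) (1 + ε / 2) := by
    refine Set.iUnion₂_subset fun x hx => Metric.ball_subset_ball' ?_
    rw [dist_zero_right]
    linarith [hs x hx]
  have key : (s.card : ℝ≥0∞) * ENNReal.ofReal ((ε / 2) ^ d) * μ (Metric.ball 0 1) ≤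
      ENNReal.ofReal ((1 + ε / 2) ^ d) * μ (Metric.ball 0 1) :=
    calc _ = μ (⋃ x ∈ s, Metric.ball (x : V) (ε / 2)) := by
          rw [measure_biUnion_finset hdisj fun x _ => measurableSet_ball]
          simp only [μ.addHaar_ball_of_pos _ (half_pos hε), Finset.sum_const, nsmul_eq_mul,
            mul_assoc, d]
      _ ≤ μ (Metric.ball (0 : V) (1 + ε / 2)) := measure_mono hsub
      _ = _ := by rw [μ.addHaar_ball_of_pos _ (by positivity)]
  have key2 : (s.card : ℝ≥0∞) * ENNReal.ofReal ((ε / 2) ^ d) ≤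
      ENNReal.ofReal ((1 + ε / 2) ^ d) :=
    (ENNReal.mul_le_mul_iff_left (Metric.measure_ball_pos _ _ zero_lt_one).ne'
      measure_ball_lt_top.ne).1 key
  have key3 : (s.card : ℝ) * (ε / 2) ^ d ≤ (1 + ε / 2) ^ d := by
    rw [← ENNReal.ofReal_natCast, ← ENNReal.ofReal_mul (by positivity)] at key2
    exact (ENNReal.ofReal_le_ofReal_iff (by positivity)).1 key2
  have : 1 + 2 / ε = (1 + ε / 2) / (ε / 2) := by field_simp; ring
  rwa [this, div_pow, le_div_iff₀ (by positivity)]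

theorem exists_net_unitBall (V : Type*) [NormedAddCommGroup V] [NormedSpace ℝ V]
    [FiniteDimensional ℝ V] {ε : ℝ} (hε : 0 < ε) :
    ∃ T : Finset V, (∀ x ∈ T, ‖x‖ ≤ 1) ∧ (T.card : ℝ) ≤ (1 + 2 / ε) ^ Module.finrank ℝ V ∧
      ∀ x : V, ‖x‖ ≤ 1 → ∃ y ∈ T, ‖x - y‖ ≤ ε := by
  classical
  set P : Set ℕ := {N | ∃ s : Finset V, (∀ x ∈ s, ‖x‖ ≤ 1) ∧
    (∀ x ∈ s, ∀ y ∈ s, x ≠ y → ε ≤ ‖x - y‖) ∧ s.card = N}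
  have hP : BddAbove P := by
    refine ⟨⌊(1 + 2 / ε) ^ Module.finrank ℝ V⌋₊, ?_⟩
    rintro N ⟨s, hs, h, rfl⟩
    exact Nat.le_floor (card_le_of_separated_unitBall hε s hs h)
  obtain ⟨T, hT, hsep, hcard⟩ := Nat.sSup_mem (s := P) ⟨0, ∅, by simp⟩ hP
  refine ⟨T, hT, card_le_of_separated_unitBall hε T hT hsep, fun x hx => ?_⟩
  by_contra! hfar
  have hxT : x ∉ T := fun hmem => by
    have := hfar x hmem
    rw [sub_self, norm_zero] at this
    linarith
  have hmem : T.card + 1 ∈ P := by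
    refine ⟨insert x T, ?_, ?_, Finset.card_insert_of_notMem hxT⟩
    · simpa using ⟨hx, hT⟩
    · intro y hy z hz hyz
      rw [Finset.mem_insert] at hy hz
      rcases hy with rfl | hy <;> rcases hz with rfl | hz
      · exact absurd rfl hyz
      · exact (hfar z hz).le
      · rw [norm_sub_rev]; exact (hfar y hy).le
      · exact hsep y hy z hz hyz
  have := le_csSup hP hmem
  omega

theorem norm_le_of_net {V W : Type*} [NormedAddCommGroup V] [NormedSpace ℝ V]
    [FiniteDimensional ℝ V] [NormedAddCommGroup W] [NormedSpace ℝ W] (f : V →ₗ[ℝ] W) {ε : ℝ}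
    (hε : ε ≤ 1) {T : Finset V} (hT : T.Nonempty)
    (hnet : ∀ x : V, ‖x‖ ≤ 1 → ∃ y ∈ T, ‖x - y‖ ≤ ε) {x : V} (hx : ‖x‖ ≤ 1) :
    (1 - ε) * ‖f x‖ ≤ T.sup' hT fun t => ‖f t‖ := by
  set L : V →L[ℝ] W := LinearMap.toContinuousLinearMap f
  have hbd : ∀ x : V, ‖x‖ ≤ 1 → ‖L x‖ ≤ T.sup' hT (fun t => ‖L t‖) + ‖L‖ * ε := fun x hx => by
    obtain ⟨y, hy, hxy⟩ := hnet x hx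
    calc ‖L x‖ = ‖L y + L (x - y)‖ := by rw [map_sub, add_sub_cancel]
      _ ≤ ‖L y‖ + ‖L‖ * ‖x - y‖ := (norm_add_le _ _).trans (by gcongr; exact L.le_opNorm _)
      _ ≤ _ := by
        gcongr
        exact Finset.le_sup' (fun t => ‖L t‖) hy
  have h0 : 0 ≤ T.sup' hT (fun t => ‖L t‖) + ‖L‖ * ε := by
    simpa using hbd 0 (by simp)
  have h1 := ContinuousLinearMap.opNorm_le_of_unit_norm h0 fun x hx => hbd x hx.le
  have h2 : (1 - ε) * ‖L x‖ ≤ (1 - ε) * ‖L‖ :=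
    mul_le_mul_of_nonneg_left ((L.le_opNorm x).trans
      (mul_le_of_le_one_right (norm_nonneg _) hx)) (by linarith)
  exact h2.trans (show (1 - ε) * ‖L‖ ≤ T.sup' hT fun t => ‖L t‖ by linarith)

variable {ι κ : Type*} [Fintype ι] [Fintype κ] [DecidableEq κ] {q : ℝ≥0∞} [Fact (1 ≤ q)]

omit [Fintype ι] [Fintype κ] [Fact (1 ≤ q)] in
theorem splitVec_add (c : ℝ) (A : ι → κ → ℝ) (S : Finset κ) (g : ι × κ → ℝ)
    (s t : EuclideanSpace ℝ κ) :
    splitVec q c A S g (s + t) = splitVec q c A S g s + splitVec q c A S g t := by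
  refine WithLp.ofLp_injective 2 (Prod.ext (WithLp.ofLp_injective q (funext fun i => ?_))
    (WithLp.ofLp_injective 2 (funext fun j => ?_)))
  · change ∑ j ∈ S, A i j * g (i, j) * (s j + t j) =
      ∑ j ∈ S, A i j * g (i, j) * s j + ∑ j ∈ S, A i j * g (i, j) * t j
    simp only [mul_add, Finset.sum_add_distrib]
  · change (if j ∈ S then 0 else c * (s j + t j)) =
      (if j ∈ S then 0 else c * s j) + if j ∈ S then 0 else c * t j
    split_ifs <;> ring

omit [Fintype ι] [Fintype κ] [Fact (1 ≤ q)] in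
theorem splitVec_smul (c : ℝ) (A : ι → κ → ℝ) (S : Finset κ) (g : ι × κ → ℝ) (r : ℝ)
    (t : EuclideanSpace ℝ κ) :
    splitVec q c A S g (r • t) = r • splitVec q c A S g t := by
  refine WithLp.ofLp_injective 2 (Prod.ext (WithLp.ofLp_injective q (funext fun i => ?_))
    (WithLp.ofLp_injective 2 (funext fun j => ?_)))
  · change ∑ j ∈ S, A i j * g (i, j) * (r * t j) = r * ∑ j ∈ S, A i j * g (i, j) * t j
    simp only [Finset.mul_sum, mul_left_comm]
  · change (if j ∈ S then 0 else c * (r * t j)) = r * if j ∈ S then 0 else c * t j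
    split_ifs <;> ring

/-- `splitVec` as a linear map in its last argument. -/
def splitLin (q : ℝ≥0∞) (c : ℝ) (A : ι → κ → ℝ) (S : Finset κ) (g : ι × κ → ℝ) :
    EuclideanSpace ℝ κ →ₗ[ℝ] WithLp 2 (PiLp q (fun _ : ι => ℝ) × EuclideanSpace ℝ κ) where
  toFun := splitVec q c A S g
  map_add' := splitVec_add c A S g
  map_smul' := splitVec_smul c A S g

theorem exists_collapse (S : Finset κ) : ∃ S' : Finset κ, S'.card ≤ S.card + 1 ∧
    ∀ t : EuclideanSpace ℝ κ, ‖t‖ ≤ 1 → ∃ u : EuclideanSpace ℝ κ, ‖u‖ ≤ 1 ∧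
      (∀ j ∉ S', u j = 0) ∧ (∀ j ∈ S, u j = t j) ∧ ∑ j ∈ Sᶜ, u j ^ 2 = ∑ j ∈ Sᶜ, t j ^ 2 := by
  rcases Finset.eq_empty_or_nonempty Sᶜ with h | ⟨j₀, hj₀⟩
  · rw [Finset.compl_eq_empty_iff] at h
    exact ⟨S, Nat.le_succ _, fun t ht => ⟨t, ht, by simp [h], by simp, rfl⟩⟩
  · refine ⟨insert j₀ S, Finset.card_insert_le _ _, fun t ht => ?_⟩
    set r := Real.sqrt (∑ j ∈ Sᶜ, t j ^ 2)
    have hr : r ^ 2 = ∑ j ∈ Sᶜ, t j ^ 2 := Real.sq_sqrt (by positivity)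
    have hj₀S : j₀ ∉ S := Finset.mem_compl.1 hj₀
    set u : EuclideanSpace ℝ κ :=
      WithLp.toLp 2 fun j => if j ∈ S then t j else if j = j₀ then r else 0
    have hS : ∀ j ∈ S, u j = t j := fun j hj => by simp [u, hj]
    have hc : ∑ j ∈ Sᶜ, u j ^ 2 = ∑ j ∈ Sᶜ, t j ^ 2 := by
      rw [← hr, Finset.sum_eq_single_of_mem j₀ hj₀]
      · simp [u, hj₀S]
      · intro j hj hne
        rw [Finset.mem_compl] at hj
        simp [u, hj, hne]
    refine ⟨u, ?_, fun j hj => ?_, hS, hc⟩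
    · refine le_trans (le_of_eq ?_) ht
      rw [EuclideanSpace.norm_eq, EuclideanSpace.norm_eq]
      simp only [Real.norm_eq_abs, sq_abs]
      rw [← Finset.sum_add_sum_compl S, hc, ← Finset.sum_add_sum_compl S (fun j => t j ^ 2)]
      congr 2
      exact Finset.sum_congr rfl fun j hj => by rw [hS j hj]
    · rw [Finset.mem_insert, not_or] at hj
      simp [u, hj.1, hj.2]

theorem exists_net_splitVec (c : ℝ) (A : ι → κ → ℝ) (S : Finset κ) {ε : ℝ} (hε : 0 < ε)
    (hε1 : ε < 1) :
    ∃ T : Finset (EuclideanSpace ℝ κ), ∃ hT : T.Nonempty, (∀ t ∈ T, ‖t‖ ≤ 1) ∧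
      (T.card : ℝ) ≤ (1 + 2 / ε) ^ (S.card + 1) ∧
      ∀ (g : ι × κ → ℝ) (t : EuclideanSpace ℝ κ), ‖t‖ ≤ 1 →
        (1 - ε) * ‖splitVec q c A S g t‖ ≤ T.sup' hT fun t => ‖splitVec q c A S g t‖ := by
  obtain ⟨S', hS', hcol⟩ := exists_collapse S
  set V : Submodule ℝ (EuclideanSpace ℝ κ) :=
    Submodule.span ℝ (S'.image fun j => EuclideanSpace.single j (1 : ℝ)) with hV
  have hdim : Module.finrank ℝ V ≤ S.card + 1 :=
    (finrank_span_finset_le_card _).trans (Finset.card_image_le.trans hS')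
  have hmemV : ∀ u : EuclideanSpace ℝ κ, (∀ j ∉ S', u j = 0) → u ∈ V := fun u hu => by
    have : u = ∑ j ∈ S', u j • EuclideanSpace.single j (1 : ℝ) := by
      ext i
      simp only [WithLp.ofLp_sum, Finset.sum_apply, PiLp.smul_apply, PiLp.single_apply,
        smul_eq_mul, mul_ite, mul_one, mul_zero, Finset.sum_ite_eq]
      split_ifs with h
      · rfl
      · exact hu i h
    rw [this]
    refine Submodule.sum_mem _ fun j hj => Submodule.smul_mem _ _ (Submodule.subset_span ?_)
    simpa using ⟨j, hj, rfl⟩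
  obtain ⟨T₀, hball, hcard, hnet⟩ := exists_net_unitBall V hε
  have hT₀ : T₀.Nonempty := by
    obtain ⟨y, hy, -⟩ := hnet 0 (by simp)
    exact ⟨y, hy⟩
  refine ⟨T₀.map ⟨Subtype.val, Subtype.val_injective⟩, hT₀.map, ?_, ?_, fun g t ht => ?_⟩
  · simp only [Finset.mem_map, Function.Embedding.coeFn_mk]
    rintro _ ⟨x, hx, rfl⟩
    exact hball x hx
  · rw [Finset.card_map]
    exact hcard.trans (pow_le_pow_right₀ (by linarith [div_pos two_pos hε]) hdim)
  · obtain ⟨u, hu1, hu0, huS, huc⟩ := hcol t ht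
    have hut : ‖splitVec q c A S g t‖ = ‖splitVec q c A S g u‖ := by
      rw [norm_splitVec, norm_splitVec, huc]
      congr 5
      ext i
      exact Finset.sum_congr rfl fun j hj => by rw [huS j hj]
    rw [hut, Finset.sup'_map]
    exact norm_le_of_net (splitLin q c A S g ∘ₗ V.subtype) hε1.le hT₀ hnet
      (x := ⟨u, hmemV u hu0⟩) hu1

end Nets

section Induction

variable {ι κ : Type*} [Fintype ι] [Fintype κ] [DecidableEq κ] {q : ℝ≥0∞} [Fact (1 ≤ q)]
  {c : ℝ} {A : ι → κ → ℝ} {S J : Finset κ}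

theorem log_card_net_le {N d k : ℕ} (hd : 1 ≤ d) (hk : 1 ≤ k)
    (hN : (N : ℝ) ≤ (1 + 2 / (1 / ((k : ℝ) + 1) ^ 2)) ^ (d + 1)) :
    Real.log N ≤ 12 * k * d := by
  have hk' : (1 : ℝ) ≤ k := by exact_mod_cast hk
  have hd' : (1 : ℝ) ≤ d := by exact_mod_cast hd
  rcases Nat.eq_zero_or_pos N with rfl | hN0
  · simp only [Nat.cast_zero, Real.log_zero]; positivity
  have h1 : Real.log N ≤ (d + 1 : ℕ) * (2 * Real.log (2 * ((k : ℝ) + 1))) := by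
    have h : Real.log (((2 * ((k : ℝ) + 1)) ^ 2) ^ (d + 1)) =
        (d + 1 : ℕ) * (2 * Real.log (2 * ((k : ℝ) + 1))) := by
      rw [Real.log_pow, Real.log_pow]; norm_num
    rw [← h]
    refine Real.log_le_log (by exact_mod_cast hN0) (hN.trans ?_)
    gcongr
    rw [div_div_eq_mul_div, div_one]
    nlinarith
  have h2 : Real.log (2 * ((k : ℝ) + 1)) ≤ 2 * (k + 1) - 1 :=
    Real.log_le_sub_one_of_pos (by positivity)
  have h3 : 0 ≤ Real.log (2 * ((k : ℝ) + 1)) := Real.log_nonneg (by linarith)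
  calc Real.log N ≤ _ := h1
    _ ≤ (2 * d) * (2 * (3 * k)) := by
      push_cast
      gcongr <;> linarith
    _ = 12 * k * d := by ring

theorem integral_sup'_norm_splitVec_union_le_of_card (hq2 : 2 ≤ q) (hq : q ≠ ⊤)
    (hSJ : Disjoint S J) (hJ : J.Nonempty) {b : ℝ≥0} (hb : ∀ i, ∀ j ∈ J, |A i j| ≤ b)
    (hc : ∀ j ∈ J, 4 * q.toReal *
      ‖(WithLp.toLp q fun i => A i j : PiLp q fun _ : ι => ℝ)‖ ^ 2 ≤ c ^ 2)
    {k : ℕ} (hk : 1 ≤ k) {M : ℝ} (hM : 0 < M)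
    (hcard : (b : ℝ) ^ 2 * (S ∪ J).card ≤ M ^ 2 / k ^ 5) {K : ℝ}
    (hK : ∀ (T : Finset (EuclideanSpace ℝ κ)) (hT : T.Nonempty), (∀ t ∈ T, ‖t‖ ≤ 1) →
      ∫ g, T.sup' hT (fun t => ‖splitVec q c A S g t‖) ∂_root_.stdGaussian (ι × κ) ≤ K)
    {T : Finset (EuclideanSpace ℝ κ)} (hT : T.Nonempty) (hball : ∀ t ∈ T, ‖t‖ ≤ 1) :
    (1 - 1 / ((k : ℝ) + 1) ^ 2) *
      ∫ g, T.sup' hT (fun t => ‖splitVec q c A (S ∪ J) g t‖) ∂_root_.stdGaussian (ι × κ) ≤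
        K + 16 * M / k ^ 2 := by
  have hk' : (1 : ℝ) ≤ k := by exact_mod_cast hk
  have hε1 : 1 / ((k : ℝ) + 1) ^ 2 < 1 := by
    rw [div_lt_one (by positivity)]; nlinarith
  obtain ⟨N, hN, hNball, hNcard, hnet⟩ :=
    exists_net_splitVec (q := q) c A (S ∪ J) (ε := 1 / ((k : ℝ) + 1) ^ 2) (by positivity) hε1
  set d := (S ∪ J).card
  have hd : 1 ≤ d := Finset.card_pos.2 (hJ.mono Finset.subset_union_right)
  have hd' : (1 : ℝ) ≤ d := by exact_mod_cast hd
  have hlog := log_card_net_le hd hk hNcard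
  have hl : 0 < 12 * k ^ 3 * d / M := by positivity
  have hcost : Real.log N.card / (12 * k ^ 3 * d / M) +
      12 * k ^ 3 * d / M * (Real.pi ^ 2 * (b : ℝ) ^ 2 / 8) ≤ 16 * M / k ^ 2 := by
    have h1 : Real.log N.card / (12 * k ^ 3 * d / M) ≤ M / k ^ 2 :=
      calc _ ≤ 12 * k * d / (12 * k ^ 3 * d / M) := by gcongr
        _ = M / k ^ 2 := by field_simp
    have hpi : Real.pi ^ 2 ≤ 10 := by
      nlinarith [Real.pi_lt_d2, Real.pi_pos]
    have h2 : 12 * k ^ 3 * d / M * (Real.pi ^ 2 * (b : ℝ) ^ 2 / 8) ≤ 15 * (M / k ^ 2) :=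
      calc _ = 12 * k ^ 3 / M * (Real.pi ^ 2 / 8) * ((b : ℝ) ^ 2 * d) := by ring
        _ ≤ 12 * k ^ 3 / M * (10 / 8) * (M ^ 2 / k ^ 5) := by gcongr
        _ = 15 * (M / k ^ 2) := by field_simp; norm_num
    calc _ ≤ M / k ^ 2 + 15 * (M / k ^ 2) := add_le_add h1 h2
      _ = _ := by ring
  have hpt : ∀ g, (1 - 1 / ((k : ℝ) + 1) ^ 2) *
      T.sup' hT (fun t => ‖splitVec q c A (S ∪ J) g t‖) ≤
        N.sup' hN fun t => ‖splitVec q c A (S ∪ J) g t‖ := fun g => by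
    obtain ⟨t, ht, hmax⟩ := Finset.exists_mem_eq_sup' hT fun t => ‖splitVec q c A (S ∪ J) g t‖
    rw [hmax]
    exact hnet g t (hball t ht)
  rw [← integral_const_mul]
  calc _ ≤ ∫ g, N.sup' hN (fun t => ‖splitVec q c A (S ∪ J) g t‖) ∂_root_.stdGaussian (ι × κ) :=
        integral_mono ((integrable_sup'_norm_splitVec hq2 hq hT hball).const_mul _)
          (integrable_sup'_norm_splitVec hq2 hq hN hNball) hpt
    _ ≤ _ := (integral_sup'_norm_splitVec_union_le hq2 hq hSJ hb hc hN hNball hl).trans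
        (add_le_add (hK N hN hNball) hcost)

/-- The union of the first `r` members of a family of finite sets. -/
def initialUnion {k₀ : ℕ} (J : Fin k₀ → Finset κ) (r : ℕ) : Finset κ :=
  (Finset.univ.filter fun l : Fin k₀ => l.1 < r).biUnion J

omit [Fintype κ] in
theorem initialUnion_succ {k₀ : ℕ} (J : Fin k₀ → Finset κ) {r : ℕ} (hr : r < k₀) :
    initialUnion J (r + 1) = initialUnion J r ∪ J ⟨r, hr⟩ := by
  ext j
  simp only [initialUnion, Finset.mem_biUnion, Finset.mem_filter, Finset.mem_univ, true_and,
    Finset.mem_union]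
  constructor
  · rintro ⟨l, hl, hj⟩
    rcases Nat.lt_succ_iff_lt_or_eq.1 hl with h | h
    · exact Or.inl ⟨l, h, hj⟩
    · right
      have : l = ⟨r, hr⟩ := Fin.ext h
      rwa [← this]
  · rintro (⟨l, hl, hj⟩ | hj)
    · exact ⟨l, by omega, hj⟩
    · exact ⟨⟨r, hr⟩, by simp, hj⟩

omit [Fintype κ] in
theorem card_initialUnion_succ_le {k₀ : ℕ} (J : Fin k₀ → Finset κ) {r : ℕ} (hr : r < k₀) {x y : ℝ}
    (hx : 0 ≤ x) (h : ∀ l : Fin k₀, l.1 ≤ r → x * (J l).card ≤ y) :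
    x * (initialUnion J (r + 1)).card ≤ (r + 1 : ℕ) * y := by
  have hcard : (Finset.univ.filter fun l : Fin k₀ => l.1 < r + 1).card ≤ r + 1 := by
    rw [← Finset.card_range (r + 1)]
    exact Finset.card_le_card_of_injOn Fin.val (fun l hl => by simpa using hl)
      Fin.val_injective.injOn
  have hy : 0 ≤ y := (by positivity : 0 ≤ x * ((J ⟨r, hr⟩).card : ℝ)).trans (h ⟨r, hr⟩ le_rfl)
  calc x * ((initialUnion J (r + 1)).card : ℝ)
      ≤ x * (∑ l : Fin k₀ with l.1 < r + 1, (J l).card : ℕ) := by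
        gcongr
        exact Finset.card_biUnion_le
    _ ≤ ∑ l : Fin k₀ with l.1 < r + 1, y := by
        rw [Nat.cast_sum, Finset.mul_sum]
        refine Finset.sum_le_sum fun l hl => h l ?_
        simp only [Finset.mem_filter, Finset.mem_univ, true_and] at hl
        omega
    _ ≤ (r + 1 : ℕ) * y := by
        rw [Finset.sum_const, nsmul_eq_mul]
        gcongr

theorem integral_sup'_norm_splitVec_initialUnion_le (hq2 : 2 ≤ q) (hq : q ≠ ⊤) (hc0 : 0 ≤ c)
    (hc : ∀ j, 4 * q.toReal *
      ‖(WithLp.toLp q fun i => A i j : PiLp q fun _ : ι => ℝ)‖ ^ 2 ≤ c ^ 2)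
    {k₀ : ℕ} (J : Fin k₀ → Finset κ) (hne : ∀ k, (J k).Nonempty)
    (hdisj : ∀ k l, k ≠ l → Disjoint (J k) (J l)) {b : Fin k₀ → ℝ≥0}
    (hb : ∀ k i, ∀ j ∈ J k, |A i j| ≤ b k) {M : ℝ} (hM : 0 < M)
    (hbM : ∀ k l : Fin k₀, l.1 ≤ k.1 →
      ((k.1 + 1 : ℕ) : ℝ) ^ 3 * Real.sqrt (J l).card * b k ≤ M)
    {r : ℕ} (hr : r ≤ k₀) (T : Finset (EuclideanSpace ℝ κ)) (hT : T.Nonempty)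
    (hball : ∀ t ∈ T, ‖t‖ ≤ 1) :
    ∫ g, T.sup' hT (fun t => ‖splitVec q c A (initialUnion J r) g t‖)
        ∂_root_.stdGaussian (ι × κ) ≤
      2 * (r + 1) / (r + 2) * (c + 32 * M * (r / (r + 1))) := by
  induction r generalizing T with
  | zero =>
    have h : ∀ g : ι × κ → ℝ,
        T.sup' hT (fun t => ‖splitVec q c A (initialUnion J 0) g t‖) ≤ c := fun g => by
      refine Finset.sup'_le _ _ fun t ht => ?_
      have h0 : initialUnion J 0 = ∅ := by simp [initialUnion]
      have hz : (WithLp.toLp q fun _ : ι => (0 : ℝ) : PiLp q fun _ : ι => ℝ) = 0 := rfl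
      have hle : ∑ j, t j ^ 2 ≤ 1 := by
        have : ‖t‖ ^ 2 ≤ 1 := pow_le_one₀ (norm_nonneg _) (hball t ht)
        simpa [EuclideanSpace.norm_sq_eq] using this
      rw [norm_splitVec, h0]
      simp only [Finset.sum_empty, hz, Finset.compl_empty, norm_zero]
      rw [Real.sqrt_le_left hc0]
      nlinarith [sq_nonneg c]
    have := integral_mono (integrable_sup'_norm_splitVec hq2 hq hT hball)
      (integrable_const c) h
    simpa using this
  | succ r ih =>
    have hr' : r < k₀ := hr
    set k : Fin k₀ := ⟨r, hr'⟩ with hk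
    have hSJ : Disjoint (initialUnion J r) (J k) := by
      rw [initialUnion, Finset.disjoint_biUnion_left]
      intro l hl
      simp only [Finset.mem_filter, Finset.mem_univ, true_and] at hl
      exact hdisj l k fun h => by rw [h] at hl; exact lt_irrefl _ hl
    have hcard : (b k : ℝ) ^ 2 * (initialUnion J r ∪ J k).card ≤ M ^ 2 / (r + 1 : ℕ) ^ 5 := by
      rw [← initialUnion_succ J hr']
      refine (card_initialUnion_succ_le J hr' (y := M ^ 2 / (r + 1 : ℕ) ^ 6) (by positivity)
        fun l hl => ?_).trans (le_of_eq ?_)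
      · rw [le_div_iff₀ (by positivity)]
        calc (b k : ℝ) ^ 2 * (J l).card * ((r + 1 : ℕ) : ℝ) ^ 6
            = (((r + 1 : ℕ) : ℝ) ^ 3 * Real.sqrt (J l).card * b k) ^ 2 := by
              rw [mul_pow, mul_pow, Real.sq_sqrt (by positivity)]; ring
          _ ≤ M ^ 2 := by
              gcongr
              exact hbM k l hl
      · field_simp
    have hstep := integral_sup'_norm_splitVec_union_le_of_card hq2 hq hSJ (hne k) (hb k)
      (fun j _ => hc j) (Nat.succ_pos r) hM hcard (ih hr'.le) hT hball
    rw [initialUnion_succ J hr']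
    set I := ∫ g, T.sup' hT (fun t => ‖splitVec q c A (initialUnion J r ∪ J k) g t‖)
        ∂_root_.stdGaussian (ι × κ)
    have hr0 : (0 : ℝ) ≤ r := Nat.cast_nonneg r
    push_cast at hstep ⊢
    set x : ℝ := (r : ℝ)
    have hfac : 1 - 1 / (x + 1 + 1) ^ 2 = (x + 1) * (x + 3) / (x + 2) ^ 2 := by
      field_simp; ring
    rw [hfac] at hstep
    have hI : I ≤ (x + 2) ^ 2 / ((x + 1) * (x + 3)) * (2 * (x + 1) / (x + 2) *
        (c + 32 * M * (x / (x + 1))) + 16 * M / (x + 1) ^ 2) := by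
      rw [div_mul_eq_mul_div, le_div_iff₀ (by positivity)]
      rw [div_mul_eq_mul_div, div_le_iff₀ (by positivity)] at hstep
      linarith
    have h1 : 16 * M / (x + 1) ^ 2 ≤ 2 * (x + 1) / (x + 2) * (32 * M / ((x + 1) * (x + 2))) := by
      rw [div_mul_div_comm, div_le_div_iff₀ (by positivity) (by positivity)]
      have : (x + 2) ^ 2 ≤ 4 * (x + 1) ^ 2 := by nlinarith
      have h2 := mul_le_mul_of_nonneg_left this (by positivity : 0 ≤ 16 * M * (x + 1))
      linarith
    calc I ≤ _ := hI
      _ ≤ (x + 2) ^ 2 / ((x + 1) * (x + 3)) * (2 * (x + 1) / (x + 2) *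
        (c + 32 * M * (x / (x + 1))) +
          2 * (x + 1) / (x + 2) * (32 * M / ((x + 1) * (x + 2)))) := by gcongr
      _ = _ := by field_simp; ring

end Induction

section OperatorNorm

variable {ι κ : Type*} [Fintype ι] [Fintype κ]

theorem holderConjugate_toReal_and_le_two {q r : ℝ≥0∞} (h : 1 / q + 1 / r = 1) (hq2 : 2 ≤ q)
    (hq : q ≠ ⊤) : q.toReal.HolderConjugate r.toReal ∧ r.toReal ≤ 2 := by
  have hqr : 2 ≤ q.toReal := by simpa using ENNReal.toReal_mono hq hq2
  have : ENNReal.HolderConjugate q r := ⟨by simpa using h⟩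
  have hconj : q.toReal.HolderConjugate r.toReal :=
    ENNReal.HolderConjugate.toReal (by linarith)
  refine ⟨hconj, ?_⟩
  rw [hconj.conjugate_eq, div_le_iff₀ (by linarith)]
  linarith

theorem lpNorm_eq_norm {r : ℝ≥0∞} [Fact (1 ≤ r)] (hr : r ≠ ⊤) (x : ι → ℝ) :
    lpNorm r x = ‖(WithLp.toLp r x : PiLp r fun _ : ι => ℝ)‖ := by
  have h0 : 0 < r.toReal :=
    ENNReal.toReal_pos (zero_lt_one.trans_le (Fact.out : 1 ≤ r)).ne' hr
  rw [PiLp.norm_eq_sum h0, _root_.lpNorm, if_neg hr]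
  rfl

theorem lpNorm_zero {r : ℝ≥0∞} (h0 : 0 < r.toReal) : lpNorm r (0 : ι → ℝ) = 0 := by
  have hr : r ≠ ⊤ := fun h => by simp [h] at h0
  simp [_root_.lpNorm, hr, Real.zero_rpow h0.ne', Real.zero_rpow (inv_pos.2 h0).ne']

theorem lpNorm_two_le_one {p : ℝ≥0∞} (h0 : 0 < p.toReal) (h2 : p.toReal ≤ 2) {t : κ → ℝ}
    (ht : lpNorm p t ≤ 1) : lpNorm 2 t ≤ 1 := by
  have hp : p ≠ ⊤ := fun h => by simp [h] at h0
  rw [_root_.lpNorm, if_neg hp] at ht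
  have hs : 0 ≤ ∑ j, |t j| ^ p.toReal := by positivity
  have hsum : ∑ j, |t j| ^ p.toReal ≤ 1 := by
    have ht' := ht.trans_eq (Real.one_rpow (1 / p.toReal)).symm
    exact (Real.rpow_le_rpow_iff hs zero_le_one (by positivity)).1 ht'
  rw [_root_.lpNorm, if_neg (by norm_num)]
  refine Real.rpow_le_one (by positivity) (le_trans (Finset.sum_le_sum fun j _ => ?_) hsum)
    (by positivity)
  have hj : |t j| ≤ 1 := by
    have := (Finset.single_le_sum (f := fun j => |t j| ^ p.toReal)
      (fun _ _ => by positivity) (Finset.mem_univ j)).trans hsum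
    rw [← Real.one_rpow p.toReal] at this
    exact (Real.rpow_le_rpow_iff (abs_nonneg _) zero_le_one h0).1 this
  rcases eq_or_ne (t j) 0 with h | h
  · simp [h, Real.zero_rpow h0.ne']
  · exact Real.rpow_le_rpow_of_exponent_ge (abs_pos.2 h) hj (by simpa using h2)

/-- The set of values of the bilinear form whose supremum is `opNorm`. -/
def bilinValues (p r : ℝ≥0∞) (M : ι → κ → ℝ) : Set ℝ :=
  { x : ℝ | ∃ s : ι → ℝ, ∃ t : κ → ℝ,
    lpNorm r s ≤ 1 ∧ lpNorm p t ≤ 1 ∧ x = ∑ i, ∑ j, M i j * s i * t j }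

theorem zero_mem_bilinValues {p r : ℝ≥0∞} (hp : 0 < p.toReal) (hr : 0 < r.toReal)
    (M : ι → κ → ℝ) : 0 ∈ bilinValues p r M :=
  ⟨0, 0, by simp [lpNorm_zero hr], by simp [lpNorm_zero hp], by simp⟩

theorem le_norm_mulVec {q r : ℝ≥0∞} [Fact (1 ≤ q)]
    (hqr : q.toReal.HolderConjugate r.toReal) {M : ι → κ → ℝ} {s : ι → ℝ} (hs : lpNorm r s ≤ 1)
    (t : κ → ℝ) : ∑ i, ∑ j, M i j * s i * t j ≤
      ‖(WithLp.toLp q fun i => ∑ j, M i j * t j : PiLp q fun _ : ι => ℝ)‖ := by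
  have hq : q ≠ ⊤ := fun h => by simpa [h] using hqr.pos
  have hr : r ≠ ⊤ := fun h => by simpa [h] using hqr.symm.pos
  have h := Real.inner_le_Lp_mul_Lq Finset.univ (fun i => ∑ j, M i j * t j) s hqr
  rw [← lpNorm_eq_norm hq]
  rw [_root_.lpNorm, if_neg hr] at hs
  calc ∑ i, ∑ j, M i j * s i * t j = ∑ i, (∑ j, M i j * t j) * s i :=
        Finset.sum_congr rfl fun i _ => by
          rw [Finset.sum_mul]
          exact Finset.sum_congr rfl fun j _ => by ring
    _ ≤ lpNorm q (fun i => ∑ j, M i j * t j) * 1 := by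
        rw [_root_.lpNorm, if_neg hq]
        exact h.trans (by gcongr)
    _ = _ := mul_one _

variable [DecidableEq κ] {q r : ℝ≥0∞} [Fact (1 ≤ q)]

theorem exists_net_bilinValues (hqr : q.toReal.HolderConjugate r.toReal) (A : ι → κ → ℝ) :
    ∃ T : Finset (EuclideanSpace ℝ κ), ∃ hT : T.Nonempty, (∀ t ∈ T, ‖t‖ ≤ 1) ∧
      ∀ g : ι × κ → ℝ, ∀ x ∈ bilinValues 2 r (fun i j => A i j * g (i, j)),
        x ≤ 2 * T.sup' hT fun t => ‖splitVec q 0 A Finset.univ g t‖ := by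
  obtain ⟨T, hT, hball, -, hnet⟩ :=
    exists_net_splitVec (q := q) 0 A Finset.univ (ε := 1 / 2) (by norm_num) (by norm_num)
  refine ⟨T, hT, hball, ?_⟩
  rintro g x ⟨s, t, hs, ht, rfl⟩
  rw [lpNorm_eq_norm (by norm_num)] at ht
  have h1 := hnet g (WithLp.toLp 2 t) ht
  have h2 := le_norm_mulVec hqr (M := fun i j => A i j * g (i, j)) hs t
  rw [norm_splitVec, Finset.compl_univ, Finset.sum_empty, mul_zero, add_zero,
    Real.sqrt_sq (norm_nonneg _)] at h1
  refine h2.trans ?_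
  change (1 - 1 / 2) * ‖(WithLp.toLp q fun i => ∑ j, A i j * g (i, j) * t j :
    PiLp q fun _ : ι => ℝ)‖ ≤ _ at h1
  linarith

theorem bddAbove_bilinValues (hqr : q.toReal.HolderConjugate r.toReal) (A : ι → κ → ℝ)
    (g : ι × κ → ℝ) : BddAbove (bilinValues 2 r fun i j => A i j * g (i, j)) := by
  obtain ⟨T, hT, -, h⟩ := exists_net_bilinValues hqr A
  exact ⟨_, h g⟩

theorem measurable_opNorm (hqr : q.toReal.HolderConjugate r.toReal) (A : ι → κ → ℝ) :
    Measurable fun g : ι × κ → ℝ => opNorm 2 r fun i j => A i j * g (i, j) := by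
  set β := { st : (ι → ℝ) × (κ → ℝ) // lpNorm r st.1 ≤ 1 ∧ lpNorm 2 st.2 ≤ 1 }
  set f : β → (ι × κ → ℝ) → ℝ := fun st g =>
    ∑ i, ∑ j, A i j * g (i, j) * st.1.1 i * st.1.2 j
  have hrange : ∀ g, Set.range (fun st => f st g) =
      bilinValues 2 r fun i j => A i j * g (i, j) := fun g => by
    ext x
    constructor
    · rintro ⟨⟨⟨s, t⟩, hs, ht⟩, rfl⟩
      exact ⟨s, t, hs, ht, rfl⟩
    · rintro ⟨s, t, hs, ht, rfl⟩
      exact ⟨⟨⟨s, t⟩, hs, ht⟩, rfl⟩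
  have hop : (fun g : ι × κ → ℝ => opNorm 2 r fun i j => A i j * g (i, j)) =
      fun g => ⨆ st, f st g := by
    funext g
    rw [iSup, hrange]
    rfl
  rw [hop]
  refine (lowerSemicontinuous_ciSup (fun g => ?_) fun st => ?_).measurable
  · rw [hrange]
    exact bddAbove_bilinValues hqr A g
  · exact Continuous.lowerSemicontinuous (by fun_prop)

theorem opNorm_nonneg (hqr : q.toReal.HolderConjugate r.toReal) (A : ι → κ → ℝ)
    (g : ι × κ → ℝ) : 0 ≤ opNorm 2 r fun i j => A i j * g (i, j) :=
  le_csSup (bddAbove_bilinValues hqr A g) (zero_mem_bilinValues (by simp) hqr.symm.pos _)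

theorem integrable_opNorm (hq2 : 2 ≤ q) (hqr : q.toReal.HolderConjugate r.toReal)
    (A : ι → κ → ℝ) :
    Integrable (fun g : ι × κ → ℝ => opNorm 2 r fun i j => A i j * g (i, j))
      (_root_.stdGaussian (ι × κ)) := by
  have hq : q ≠ ⊤ := fun h => by simpa [h] using hqr.pos
  obtain ⟨T, hT, hball, h⟩ := exists_net_bilinValues hqr A
  refine ((integrable_sup'_norm_splitVec (c := 0) (A := A) (S := Finset.univ) hq2 hq hT
    hball).const_mul 2).mono'
    (measurable_opNorm hqr A).aestronglyMeasurable (ae_of_all _ fun g => ?_)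
  rw [Real.norm_of_nonneg (opNorm_nonneg hqr A g)]
  exact csSup_le ⟨0, zero_mem_bilinValues (by simp) hqr.symm.pos _⟩ (h g)

theorem integral_opNorm_le (hq2 : 2 ≤ q) (hqr : q.toReal.HolderConjugate r.toReal)
    (A : ι → κ → ℝ) {c K : ℝ}
    (hK : ∀ (T : Finset (EuclideanSpace ℝ κ)) (hT : T.Nonempty), (∀ t ∈ T, ‖t‖ ≤ 1) →
      ∫ g, T.sup' hT (fun t => ‖splitVec q c A Finset.univ g t‖)
        ∂_root_.stdGaussian (ι × κ) ≤ K) :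
    ∫ g : ι × κ → ℝ, opNorm 2 r (fun i j => A i j * g (i, j)) ∂_root_.stdGaussian (ι × κ) ≤
      2 * K := by
  have hq : q ≠ ⊤ := fun h => by simpa [h] using hqr.pos
  obtain ⟨T, hT, hball, h⟩ := exists_net_bilinValues hqr A
  have hc : ∀ g t, ‖splitVec q 0 A Finset.univ g t‖ = ‖splitVec q c A Finset.univ g t‖ :=
    fun g t => by simp [norm_splitVec]
  calc _ ≤ ∫ g, 2 * T.sup' hT (fun t => ‖splitVec q 0 A Finset.univ g t‖)
          ∂_root_.stdGaussian (ι × κ) :=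
        integral_mono (integrable_opNorm hq2 hqr A)
          ((integrable_sup'_norm_splitVec hq2 hq hT hball).const_mul 2) fun g =>
            csSup_le ⟨0, zero_mem_bilinValues (by simp) hqr.symm.pos _⟩ (h g)
    _ ≤ 2 * K := by
        simp only [hc, integral_const_mul]
        exact mul_le_mul_of_nonneg_left (hK T hT hball) two_pos.le

theorem integral_opNorm_mono {p : ℝ≥0∞} (hp0 : 0 < p.toReal) (hp2 : p.toReal ≤ 2)
    (hq2 : 2 ≤ q) (hqr : q.toReal.HolderConjugate r.toReal) (A : ι → κ → ℝ) :
    ∫ g : ι × κ → ℝ, opNorm p r (fun i j => A i j * g (i, j)) ∂_root_.stdGaussian (ι × κ) ≤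
      ∫ g : ι × κ → ℝ, opNorm 2 r (fun i j => A i j * g (i, j))
        ∂_root_.stdGaussian (ι × κ) := by
  have hsub : ∀ g : ι × κ → ℝ, bilinValues p r (fun i j => A i j * g (i, j)) ⊆
      bilinValues 2 r (fun i j => A i j * g (i, j)) := by
    rintro g x ⟨s, t, hs, ht, rfl⟩
    exact ⟨s, t, hs, lpNorm_two_le_one hp0 hp2 ht, rfl⟩
  have h0 : ∀ g : ι × κ → ℝ, 0 ∈ bilinValues p r (fun i j => A i j * g (i, j)) :=
    fun g => zero_mem_bilinValues hp0 hqr.symm.pos _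
  refine integral_mono_of_nonneg (ae_of_all _ fun g => ?_) (integrable_opNorm hq2 hqr A)
    (ae_of_all _ fun g => ?_)
  · exact le_csSup ((bddAbove_bilinValues hqr A g).mono (hsub g)) (h0 g)
  · exact csSup_le_csSup (bddAbove_bilinValues hqr A g) ⟨0, h0 g⟩ (hsub g)

end OperatorNorm

/-- Proposition: dimension-free bound via a partition of columns:
for every partition `J 0, …, J (k0-1)` of the columns into nonempty sets,
`E‖G_A‖_{p→q} ≤ E‖G_A‖_{2→q} ≤ C(√q D2 + max_{1≤k≤k0} max_{1≤l≤k} k³ |J_l|^{1/2} max_{i, j∈J_k}|a_{ij}|)`.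
Here `k, l` are `1`-indexed: the block `J k` for `k : Fin k0` plays the role of
`J_{k+1}`, so the factor `k³` reads `(k.1+1)³`. -/
theorem prop_sqrtJk :
    ∃ C : ℝ, 0 < C ∧
      ∀ p pstar q qstar : ℝ≥0∞,
        1 / p + 1 / pstar = 1 → 1 / q + 1 / qstar = 1 →
        2 ≤ pstar → pstar ≠ ⊤ → 2 ≤ q → q ≠ ⊤ →
        ∀ (m n k0 : ℕ), 0 < m → 0 < n → 0 < k0 →
        ∀ A : Fin m → Fin n → ℝ, ∀ J : Fin k0 → Finset (Fin n),
          (∀ k, (J k).Nonempty) →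
          (∀ k l, k ≠ l → Disjoint (J k) (J l)) →
          (∀ j : Fin n, ∃ k, j ∈ J k) →
          EopNorm p qstar A ≤ EopNorm 2 qstar A ∧
          EopNorm 2 qstar A ≤
            C * (Real.sqrt q.toReal * D2 q A +
              ⨆ k : Fin k0, ⨆ l : { l : Fin k0 // l.1 ≤ k.1 },
                ((k.1 + 1 : ℕ) : ℝ) ^ (3 : ℕ) *
                  Real.sqrt ((J l.1).card : ℝ) *
                  ⨆ i : Fin m, ⨆ j : { j : Fin n // j ∈ J k }, |A i j.1|) := by
  refine ⟨128, by norm_num, ?_⟩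
  intro p pstar q qstar hp hqs hp2 hptop hq2 hqtop m n k0 _ _ _ A J hne hdisj hcov
  have : Fact (1 ≤ q) := ⟨le_trans (by norm_num) hq2⟩
  obtain ⟨hqr, -⟩ := holderConjugate_toReal_and_le_two hqs hq2 hqtop
  obtain ⟨hpp, hp2'⟩ := holderConjugate_toReal_and_le_two (add_comm (1 / p) _ ▸ hp) hp2 hptop
  refine ⟨integral_opNorm_mono hpp.symm.pos hp2' hq2 hqr A, ?_⟩
  set b : Fin k0 → ℝ := fun k => ⨆ i : Fin m, ⨆ j : { j : Fin n // j ∈ J k }, |A i j.1|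
  have hb0 : ∀ k, 0 ≤ b k := fun k =>
    Real.iSup_nonneg fun i => Real.iSup_nonneg fun j => abs_nonneg _
  have hb : ∀ k i, ∀ j ∈ J k, |A i j| ≤ b k := fun k i j hj =>
    (le_ciSup (f := fun j : { j : Fin n // j ∈ J k } => |A i j.1|)
      (Set.finite_range _).bddAbove ⟨j, hj⟩).trans
      (le_ciSup (f := fun i => ⨆ j : { j : Fin n // j ∈ J k }, |A i j.1|)
        (Set.finite_range _).bddAbove i)
  set M : ℝ := ⨆ k : Fin k0, ⨆ l : { l : Fin k0 // l.1 ≤ k.1 },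
    ((k.1 + 1 : ℕ) : ℝ) ^ 3 * Real.sqrt ((J l.1).card : ℝ) * b k
  have hM0 : 0 ≤ M := Real.iSup_nonneg fun k => Real.iSup_nonneg fun l =>
    mul_nonneg (by positivity) (hb0 k)
  have hbM : ∀ k l : Fin k0, l.1 ≤ k.1 →
      ((k.1 + 1 : ℕ) : ℝ) ^ 3 * Real.sqrt (J l).card * b k ≤ M := fun k l hl =>
    (le_ciSup (f := fun l : { l : Fin k0 // l.1 ≤ k.1 } =>
        ((k.1 + 1 : ℕ) : ℝ) ^ 3 * Real.sqrt ((J l.1).card : ℝ) * b k)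
      (Set.finite_range _).bddAbove ⟨l, hl⟩).trans
      (le_ciSup (f := fun k : Fin k0 => ⨆ l : { l : Fin k0 // l.1 ≤ k.1 },
        ((k.1 + 1 : ℕ) : ℝ) ^ 3 * Real.sqrt ((J l.1).card : ℝ) * b k)
        (Set.finite_range _).bddAbove k)
  have hcol : ∀ j, ‖(WithLp.toLp q fun i => A i j : PiLp q fun _ : Fin m => ℝ)‖ ≤ D2 q A :=
    fun j => by
      rw [← lpNorm_eq_norm hqtop]
      exact le_ciSup (f := fun j => lpNorm q fun i => A i j) (Set.finite_range _).bddAbove j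
  have hD0 : 0 ≤ D2 q A := Real.iSup_nonneg fun j => by
    rw [lpNorm_eq_norm hqtop]; exact norm_nonneg _
  have hc : ∀ j, 4 * q.toReal * ‖(WithLp.toLp q fun i => A i j :
      PiLp q fun _ : Fin m => ℝ)‖ ^ 2 ≤ (2 * Real.sqrt q.toReal * D2 q A) ^ 2 := fun j =>
    calc _ ≤ 4 * q.toReal * D2 q A ^ 2 := by
          gcongr
          exact hcol j
      _ = _ := by rw [mul_pow, mul_pow, Real.sq_sqrt ENNReal.toReal_nonneg]; ring
  have huniv : initialUnion J k0 = Finset.univ := by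
    refine Finset.eq_univ_of_forall fun j => ?_
    obtain ⟨k, hk⟩ := hcov j
    simp only [initialUnion, Finset.mem_biUnion, Finset.mem_filter, Finset.mem_univ, true_and]
    exact ⟨k, k.2, hk⟩
  refine le_of_forall_pos_le_add fun δ hδ => ?_
  have hM' : 0 < M + δ / 128 := by positivity
  refine (integral_opNorm_le (c := 2 * Real.sqrt q.toReal * D2 q A)
    (K := 2 * (2 * Real.sqrt q.toReal * D2 q A + 32 * (M + δ / 128))) hq2 hqr A
    fun T hT hball => ?_).trans ?_
  · have h := integral_sup'_norm_splitVec_initialUnion_le hq2 hqtop (by positivity) hc J hne hdisj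
      (b := fun k => ⟨b k, hb0 k⟩) hb hM' (fun k l hl => (hbM k l hl).trans (by linarith))
      le_rfl T hT hball
    rw [huniv] at h
    refine h.trans (mul_le_mul ?_ (add_le_add le_rfl ?_) (by positivity) two_pos.le)
    · rw [div_le_iff₀ (by positivity)]
      linarith
    · refine mul_le_of_le_one_right (by positivity) ?_
      rw [div_le_one (by positivity)]
      linarith
  · have : 0 ≤ Real.sqrt q.toReal * D2 q A := by positivity
    linarith
end
end

section
/- For every ρ_0 ≥ 1 there is a constant C(ρ_0) > 0 depending only on ρ_0 with the following property. Let 1 ≤ ρ ≤ ρ_0, c ∈ (0,1], n a positive integer, and let m_1,…,m_n ≥ 0, σ_1,…,σ_n ≥ 0. Let Z_1, …, Z_n be nonnegative random variables (not necessarily independent) such that P(Z_j ≥ m_j + t·σ_j) ≤ e^{−t²/2} for every t ≥ 0 and every 1 ≤ j ≤ n. Then E sup_{u ∈ B_2^n ∩ c·B_∞^n} ( Σ_{j=1}^n u_j² Z_j^ρ )^{1/ρ} ≤ C(ρ_0)·( max_j m_j + √(Log(n c²))·max_j σ_j ). -/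
open MeasureTheory ProbabilityTheory
open scoped ENNReal NNReal

noncomputable section

/-- Powers are dominated by Gaussian exponentials, uniformly in the scale `L ≥ 1`. -/
lemma max_one_rpow_le_mul_one_add_exp {ρ ρ0 L v : ℝ} (hρ : 1 ≤ ρ) (hρ0 : ρ ≤ ρ0)
    (hL : 1 ≤ L) :
    max 1 (v / √L) ^ ρ ≤ Real.exp (ρ0 ^ 2 + 1) * (1 + Real.exp (v ^ 2 / 4 - L)) := by
  set y := max 1 (v / √L) with hy
  have hy1 : 1 ≤ y := le_max_left _ _
  have hpow : y ^ ρ ≤ Real.exp (ρ0 * y) := by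
    rw [Real.rpow_def_of_pos (by linarith), Real.exp_le_exp]
    have h1 : Real.log y ≤ y := Real.log_le_self (by linarith)
    have h2 : 0 ≤ Real.log y := Real.log_nonneg hy1
    nlinarith
  refine hpow.trans ?_
  rcases le_or_gt y 2 with h2 | h2
  · have h : Real.exp (ρ0 * y) ≤ Real.exp (ρ0 ^ 2 + 1) := by
      rw [Real.exp_le_exp]
      nlinarith [sq_nonneg (ρ0 - 1)]
    exact h.trans (le_mul_of_one_le_right (by positivity)
      (le_add_of_nonneg_right (by positivity)))
  · have hyv : y = v / √L := by
      rcases max_choice 1 (v / √L) with h | h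
      · rw [← hy] at h
        linarith
      · rw [← hy] at h
        exact h
    have hv : v ^ 2 = L * y ^ 2 := by
      rw [hyv, div_pow, Real.sq_sqrt (by linarith)]
      field_simp
    have h : Real.exp (ρ0 * y) ≤
        Real.exp (ρ0 ^ 2 + 1) * Real.exp (v ^ 2 / 4 - L) := by
      rw [← Real.exp_add, Real.exp_le_exp, hv]
      nlinarith [sq_nonneg (y / 2 - ρ0), mul_nonneg (sub_nonneg.2 hL)
        (by nlinarith : 0 ≤ y ^ 2 / 4 - 1)]
    have : 0 < Real.exp (ρ0 ^ 2 + 1) := Real.exp_pos _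
    linarith

/-- The expectation of `exp (V² / 4)` is at most `2` for a standard subgaussian tail. -/
lemma lintegral_exp_sq_div_four_le_two {Ω : Type*} [MeasurableSpace Ω] (P : Measure Ω)
    [IsProbabilityMeasure P] {V : Ω → ℝ} (hV : Measurable V) (hV0 : ∀ ω, 0 ≤ V ω)
    (htail : ∀ t : ℝ, 0 < t → P {ω | t ≤ V ω} ≤ ENNReal.ofReal (Real.exp (-t ^ 2 / 2))) :
    ∫⁻ ω, ENNReal.ofReal (Real.exp (V ω ^ 2 / 4)) ∂P ≤ 2 := by
  rw [lintegral_eq_lintegral_meas_le P (Filter.Eventually.of_forall fun ω => (Real.exp_pos _).le)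
    (by fun_prop), ← Set.Ioc_union_Ioi_eq_Ioi (zero_le_one' ℝ)]
  refine (lintegral_union_le _ _ _).trans ?_
  have h1 : ∫⁻ s in Set.Ioc (0 : ℝ) 1, P {ω | s ≤ Real.exp (V ω ^ 2 / 4)} ≤ 1 := by
    calc _ ≤ ∫⁻ s in Set.Ioc (0 : ℝ) 1, 1 := lintegral_mono fun s => prob_le_one
      _ = 1 := by simp
  have h2 : ∫⁻ s in Set.Ioi (1 : ℝ), P {ω | s ≤ Real.exp (V ω ^ 2 / 4)} ≤ 1 := by
    calc _ ≤ ∫⁻ s in Set.Ioi (1 : ℝ), ENNReal.ofReal (s ^ (-2 : ℝ)) := by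
          refine setLIntegral_mono' measurableSet_Ioi fun s hs => ?_
          have hs1 : 1 < s := hs
          have hlog : 0 < Real.log s := Real.log_pos hs1
          have hsub : {ω | s ≤ Real.exp (V ω ^ 2 / 4)} ⊆ {ω | 2 * √(Real.log s) ≤ V ω} := by
            intro ω hω
            have h : Real.log s ≤ V ω ^ 2 / 4 := (Real.log_le_iff_le_exp (by linarith)).2 hω
            refine (abs_le_of_sq_le_sq' ?_ (hV0 ω)).2
            rw [mul_pow, Real.sq_sqrt hlog.le]
            linarith
          refine (measure_mono hsub).trans ((htail _ (by positivity)).trans_eq ?_)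
          congr 1
          rw [Real.rpow_def_of_pos (by linarith), mul_pow, neg_div, mul_div_right_comm,
            Real.sq_sqrt hlog.le]
          congr 1
          ring
      _ = ENNReal.ofReal (∫ s in Set.Ioi (1 : ℝ), s ^ (-2 : ℝ)) := by
          rw [ofReal_integral_eq_lintegral_ofReal
            (integrableOn_Ioi_rpow_of_lt (by norm_num) one_pos)]
          refine (ae_restrict_iff' measurableSet_Ioi).2 (Filter.Eventually.of_forall fun s hs => ?_)
          exact Real.rpow_nonneg (zero_le_one.trans (le_of_lt hs)) _
      _ = 1 := by
          rw [integral_Ioi_rpow_of_lt (by norm_num) one_pos]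
          norm_num
  calc _ ≤ (1 : ℝ≥0∞) + 1 := add_le_add h1 h2
    _ = 2 := one_add_one_eq_two

/-- Pointwise domination of a flat weighted average by a sum of exponentials. -/
lemma flat_average_le {n : ℕ} {ρ ρ0 c L D : ℝ} (hρ : 1 ≤ ρ) (hρ0 : ρ ≤ ρ0) (hc : 0 < c)
    (hL : 1 ≤ L) (hD : 0 ≤ D) {z v u : Fin n → ℝ} (hz : ∀ j, 0 ≤ z j)
    (hzv : ∀ j, z j ≤ D * max 1 (v j / √L)) (hu : ∑ j, u j ^ 2 ≤ 1) (huc : ∀ j, |u j| ≤ c) :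
    (∑ j, u j ^ 2 * z j ^ ρ) ^ (1 / ρ) ≤
      D * Real.exp (ρ0 ^ 2 + 1) *
        (1 + c ^ 2 * Real.exp (-L) * ∑ j, Real.exp (v j ^ 2 / 4)) := by
  set K := Real.exp (ρ0 ^ 2 + 1) with hK
  set Y := c ^ 2 * Real.exp (-L) * ∑ j, Real.exp (v j ^ 2 / 4) with hY
  have hK1 : 1 ≤ K := Real.one_le_exp (by positivity)
  have hY0 : 0 ≤ Y := by positivity
  have hDρ : 0 ≤ D ^ ρ := Real.rpow_nonneg hD _
  have hterm : ∀ j, u j ^ 2 * z j ^ ρ ≤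
      D ^ ρ * K * (u j ^ 2 + c ^ 2 * Real.exp (-L) * Real.exp (v j ^ 2 / 4)) := by
    intro j
    have h1 : z j ^ ρ ≤ D ^ ρ * (K * (1 + Real.exp (v j ^ 2 / 4 - L))) := by
      calc z j ^ ρ ≤ (D * max 1 (v j / √L)) ^ ρ :=
            Real.rpow_le_rpow (hz j) (hzv j) (by linarith)
        _ = D ^ ρ * max 1 (v j / √L) ^ ρ :=
            Real.mul_rpow hD (zero_le_one.trans (le_max_left _ _))
        _ ≤ _ := mul_le_mul_of_nonneg_left (max_one_rpow_le_mul_one_add_exp hρ hρ0 hL) hDρ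
    have h2 : u j ^ 2 ≤ c ^ 2 := sq_le_sq' (abs_le.1 (huc j)).1 (abs_le.1 (huc j)).2
    have h3 : Real.exp (v j ^ 2 / 4 - L) = Real.exp (-L) * Real.exp (v j ^ 2 / 4) := by
      rw [← Real.exp_add]
      congr 1
      ring
    calc u j ^ 2 * z j ^ ρ
        ≤ u j ^ 2 * (D ^ ρ * (K * (1 + Real.exp (v j ^ 2 / 4 - L)))) :=
          mul_le_mul_of_nonneg_left h1 (sq_nonneg _)
      _ = D ^ ρ * K * (u j ^ 2 + u j ^ 2 * (Real.exp (-L) * Real.exp (v j ^ 2 / 4))) := by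
          rw [h3]
          ring
      _ ≤ D ^ ρ * K * (u j ^ 2 + c ^ 2 * (Real.exp (-L) * Real.exp (v j ^ 2 / 4))) := by
          gcongr
      _ = _ := by ring
  have hKY : 1 ≤ K * (1 + Y) := by nlinarith
  have hsum : ∑ j, u j ^ 2 * z j ^ ρ ≤ (D * K * (1 + Y)) ^ ρ := by
    calc ∑ j, u j ^ 2 * z j ^ ρ
        ≤ ∑ j, D ^ ρ * K * (u j ^ 2 + c ^ 2 * Real.exp (-L) * Real.exp (v j ^ 2 / 4)) :=
          Finset.sum_le_sum fun j _ => hterm j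
      _ = D ^ ρ * K * (∑ j, u j ^ 2 + Y) := by
          rw [← Finset.mul_sum, Finset.sum_add_distrib, ← Finset.mul_sum]
      _ ≤ D ^ ρ * K * (1 + Y) := by gcongr
      _ = D ^ ρ * (K * (1 + Y)) := by ring
      _ ≤ D ^ ρ * (K * (1 + Y)) ^ ρ :=
          mul_le_mul_of_nonneg_left (Real.self_le_rpow_of_one_le hKY hρ) hDρ
      _ = (D * K * (1 + Y)) ^ ρ := by
          rw [mul_assoc D, Real.mul_rpow hD (by linarith)]
  have h0 : 0 ≤ ∑ j, u j ^ 2 * z j ^ ρ :=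
    Finset.sum_nonneg fun j _ => mul_nonneg (sq_nonneg _) (Real.rpow_nonneg (hz j) _)
  rw [one_div]
  exact (Real.rpow_inv_le_iff_of_pos h0 (by positivity) (by linarith)).2 hsum

/-- Lemma: flat averages of subgaussian-tailed variables:
if `1 ≤ ρ ≤ ρ0`, `c ∈ (0,1]` and nonnegative random variables `Z_j` satisfy
`P(Z_j ≥ m_j + tσ_j) ≤ e^{−t²/2}` for all `t ≥ 0`, then
`E sup_{u ∈ B_2 ∩ c B_∞} (Σ u_j² Z_j^ρ)^{1/ρ} ≤ C(ρ0)(max_j m_j + √(Log(n c²)) max_j σ_j)`. -/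
theorem flat_subgaussian_lemma (ρ0 : ℝ) (hρ0 : 1 ≤ ρ0) :
    ∃ C : ℝ, 0 < C ∧
      ∀ ρ : ℝ, 1 ≤ ρ → ρ ≤ ρ0 →
      ∀ c : ℝ, 0 < c → c ≤ 1 →
      ∀ (n : ℕ), 0 < n →
      ∀ mm σ : Fin n → ℝ, (∀ j, 0 ≤ mm j) → (∀ j, 0 ≤ σ j) →
      ∀ (Ω : Type) (mΩ : MeasurableSpace Ω) (P : Measure Ω),
        IsProbabilityMeasure P →
      ∀ Z : Fin n → Ω → ℝ,
        (∀ j, Measurable (Z j)) →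
        (∀ j ω, 0 ≤ Z j ω) →
        (∀ j, ∀ t : ℝ, 0 ≤ t →
          P {ω | mm j + t * σ j ≤ Z j ω} ≤ ENNReal.ofReal (Real.exp (-t ^ 2 / 2))) →
        (∫ ω, sSup { x : ℝ | ∃ u : Fin n → ℝ,
            (∑ j, u j ^ 2) ≤ 1 ∧ (∀ j, |u j| ≤ c) ∧
            x = (∑ j, u j ^ 2 * Z j ω ^ ρ) ^ (1 / ρ) } ∂P) ≤
          C * ((⨆ j, mm j) + Real.sqrt (Log ((n : ℝ) * c ^ 2)) * ⨆ j, σ j) := by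
  refine ⟨3 * Real.exp (ρ0 ^ 2 + 1), by positivity, ?_⟩
  intro ρ hρ hρρ0 c hc _ n hn mm σ hmm hσ Ω mΩ P hP Z hZ hZ0 htail
  set M := ⨆ j, mm j with hM
  set S := ⨆ j, σ j with hS
  set L := Log ((n : ℝ) * c ^ 2) with hL
  set K := Real.exp (ρ0 ^ 2 + 1) with hK
  set D := M + √L * S with hD
  have hmM : ∀ j, mm j ≤ M := le_ciSup (Set.finite_range mm).bddAbove
  have hσS : ∀ j, σ j ≤ S := le_ciSup (Set.finite_range σ).bddAbove
  have hM0 : 0 ≤ M := Real.iSup_nonneg hmm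
  have hS0 : 0 ≤ S := Real.iSup_nonneg hσ
  have hL1 : 1 ≤ L := le_max_left _ _
  have hD0 : 0 ≤ D := by positivity
  have hLn : (n : ℝ) * c ^ 2 * Real.exp (-L) ≤ 1 := by
    have hpos : 0 < (n : ℝ) * c ^ 2 := by positivity
    have h : (n : ℝ) * c ^ 2 ≤ Real.exp L :=
      (Real.log_le_iff_le_exp hpos).1 (le_max_right _ _)
    calc (n : ℝ) * c ^ 2 * Real.exp (-L) ≤ Real.exp L * Real.exp (-L) := by gcongr
      _ = 1 := by rw [← Real.exp_add, add_neg_cancel, Real.exp_zero]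
  let V : Fin n → Ω → ℝ := fun j ω => max 0 ((Z j ω - M) / S)
  have hVm : ∀ j, Measurable (V j) := fun j =>
    measurable_const.max (((hZ j).sub_const M).div_const S)
  have hV0 : ∀ j ω, 0 ≤ V j ω := fun j ω => le_max_left _ _
  have hVtail : ∀ j, ∀ t : ℝ, 0 < t →
      P {ω | t ≤ V j ω} ≤ ENNReal.ofReal (Real.exp (-t ^ 2 / 2)) := by
    intro j t ht
    refine (measure_mono ?_).trans (htail j t ht.le)
    intro ω hω
    have h : t ≤ (Z j ω - M) / S := (le_max_iff.1 hω).resolve_left (not_le.2 ht)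
    have hSpos : 0 < S := by
      refine hS0.lt_of_ne fun h0 => ?_
      rw [← h0, div_zero] at h
      linarith
    rw [le_div_iff₀ hSpos] at h
    have := mul_le_mul_of_nonneg_left (hσS j) ht.le
    have := hmM j
    change mm j + t * σ j ≤ Z j ω
    linarith
  have hZV : ∀ᵐ ω ∂P, ∀ j, Z j ω ≤ D * max 1 (V j ω / √L) := by
    rw [ae_all_iff]
    intro j
    have hle : ∀ᵐ ω ∂P, Z j ω ≤ M + S * V j ω := by
      rcases hS0.eq_or_lt with h0 | hpos
      · have hσ0 : σ j = 0 := le_antisymm (h0 ▸ hσS j) (hσ j)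
        have hnull : P {ω | mm j ≤ Z j ω} = 0 := by
          have hb : ∀ t : ℝ, 0 ≤ t →
              P {ω | mm j ≤ Z j ω} ≤ ENNReal.ofReal (Real.exp (-t ^ 2 / 2)) := by
            intro t ht
            simpa [hσ0] using htail j t ht
          have hlim : Filter.Tendsto (fun t : ℝ => ENNReal.ofReal (Real.exp (-t ^ 2 / 2)))
              Filter.atTop (nhds 0) := by
            rw [← ENNReal.ofReal_zero]
            refine ENNReal.tendsto_ofReal (Real.tendsto_exp_atBot.comp ?_)
            have := (Filter.tendsto_pow_atTop (α := ℝ) two_ne_zero).atTop_div_const two_pos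
            refine (Filter.tendsto_neg_atTop_atBot.comp this).congr fun t => ?_
            simp [neg_div]
          exact nonpos_iff_eq_zero.1
            (ge_of_tendsto hlim (Filter.eventually_atTop.2 ⟨0, hb⟩))
        filter_upwards [measure_eq_zero_iff_ae_notMem.1 hnull] with ω hω
        have h : Z j ω < mm j := not_le.1 hω
        rw [← h0, zero_mul, add_zero]
        exact h.le.trans (hmM j)
      · refine Filter.Eventually.of_forall fun ω => ?_
        have h : (Z j ω - M) / S ≤ V j ω := le_max_right _ _
        rw [div_le_iff₀ hpos] at h
        linarith
    filter_upwards [hle] with ω hω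
    have hsq : 0 < √L := Real.sqrt_pos.2 (by linarith)
    have h1 : M ≤ M * max 1 (V j ω / √L) := le_mul_of_one_le_right hM0 (le_max_left _ _)
    have h2 : S * V j ω ≤ √L * S * max 1 (V j ω / √L) := by
      calc S * V j ω = √L * S * (V j ω / √L) := by field_simp
        _ ≤ _ := mul_le_mul_of_nonneg_left (le_max_right _ _) (by positivity)
    rw [hD, add_mul]
    linarith
  have hEexp : ∀ j, Integrable (fun ω => Real.exp (V j ω ^ 2 / 4)) P ∧
      ∫ ω, Real.exp (V j ω ^ 2 / 4) ∂P ≤ 2 := by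
    intro j
    have hb := lintegral_exp_sq_div_four_le_two P (hVm j) (hV0 j) (hVtail j)
    have hmeas : Measurable fun ω => Real.exp (V j ω ^ 2 / 4) :=
      (((hVm j).pow_const 2).div_const 4).exp
    have hnn : 0 ≤ᵐ[P] fun ω => Real.exp (V j ω ^ 2 / 4) :=
      Filter.Eventually.of_forall fun ω => (Real.exp_pos _).le
    refine ⟨⟨hmeas.aestronglyMeasurable, ?_⟩, ?_⟩
    · rw [hasFiniteIntegral_iff_ofReal hnn]
      exact hb.trans_lt (by simp)
    · rw [integral_eq_lintegral_of_nonneg_ae hnn hmeas.aestronglyMeasurable]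
      simpa using ENNReal.toReal_mono (by simp) hb
  have hsumint : Integrable (fun ω => ∑ j, Real.exp (V j ω ^ 2 / 4)) P :=
    integrable_finsetSum _ fun j _ => (hEexp j).1
  have hGint : Integrable (fun ω => D * K *
      (1 + c ^ 2 * Real.exp (-L) * ∑ j, Real.exp (V j ω ^ 2 / 4))) P :=
    ((integrable_const 1).add (hsumint.const_mul _)).const_mul _
  calc _ ≤ ∫ ω, D * K * (1 + c ^ 2 * Real.exp (-L) * ∑ j, Real.exp (V j ω ^ 2 / 4)) ∂P := by
        refine integral_mono_of_nonneg (Filter.Eventually.of_forall fun ω => ?_) hGint ?_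
        · refine Real.sSup_nonneg ?_
          rintro x ⟨u, -, -, rfl⟩
          exact Real.rpow_nonneg (Finset.sum_nonneg fun j _ =>
            mul_nonneg (sq_nonneg _) (Real.rpow_nonneg (hZ0 j ω) _)) _
        · filter_upwards [hZV] with ω hω
          refine Real.sSup_le ?_ (by positivity)
          rintro x ⟨u, hu, huc, rfl⟩
          exact flat_average_le hρ hρρ0 hc hL1 hD0 (fun j => hZ0 j ω) hω hu huc
    _ = D * K * (1 + c ^ 2 * Real.exp (-L) * ∑ j, ∫ ω, Real.exp (V j ω ^ 2 / 4) ∂P) := by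
        rw [integral_const_mul, integral_add (integrable_const 1) (hsumint.const_mul _),
          integral_const_mul, integral_finsetSum _ fun j _ => (hEexp j).1]
        simp
    _ ≤ D * K * (1 + c ^ 2 * Real.exp (-L) * ∑ _j : Fin n, 2) := by
        gcongr with j
        exact (hEexp j).2
    _ = D * K * (1 + 2 * ((n : ℝ) * c ^ 2 * Real.exp (-L))) := by
        simp only [Finset.sum_const, Finset.card_univ, Fintype.card_fin, nsmul_eq_mul]
        ring
    _ ≤ D * K * (1 + 2 * 1) := by gcongr
    _ = 3 * K * D := by ring
end
end
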